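/- arXiv:1605.07658 — 11 statements merged into one kernel-verified Lean document; each statement's English description precedes it below -/
import Mathlib

section
/- Suppose (u₁, u₂, p₁, p₂) satisfies the non-dimensional one-dimensional double porosity/permeability system on (0,1). Then the mass-transfer function χ := p₂ - p₁ is twice differentiable on (0,1) and satisfies χ''(x) = η²·χ(x) for all x ∈ (0,1), where η := √(μ(k₁+k₂)/(k₁k₂)). -/
open Set

/-- For a solution `(u₁, u₂, p₁, p₂)` of the non-dimensional one-dimensional
double porosity/permeability system on `(0,1)`, the mass transfer `χ := p₂ - p₁` is twice
differentiable on `(0,1)` and satisfies `χ'' = η² χ` there, where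
`η := √(μ(k₁+k₂)/(k₁k₂))`. -/
theorem mass_transfer_second_order_ode
    (μ k₁ k₂ η : ℝ) (hμ : 0 < μ) (hk₁ : 0 < k₁) (hk₂ : 0 < k₂)
    (hη : η = Real.sqrt (μ * (k₁ + k₂) / (k₁ * k₂)))
    (u₁ u₂ p₁ p₂ : ℝ → ℝ)
    (hu₁ : ∀ x ∈ Ioo (0:ℝ) 1, DifferentiableAt ℝ u₁ x)
    (hu₂ : ∀ x ∈ Ioo (0:ℝ) 1, DifferentiableAt ℝ u₂ x)
    (hp₁ : ∀ x ∈ Ioo (0:ℝ) 1, DifferentiableAt ℝ p₁ x)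
    (hp₂ : ∀ x ∈ Ioo (0:ℝ) 1, DifferentiableAt ℝ p₂ x)
    (heq₁ : ∀ x ∈ Ioo (0:ℝ) 1, μ / k₁ * u₁ x + deriv p₁ x = 0)
    (heq₂ : ∀ x ∈ Ioo (0:ℝ) 1, deriv u₁ x = -(p₁ x - p₂ x))
    (heq₃ : ∀ x ∈ Ioo (0:ℝ) 1, μ / k₂ * u₂ x + deriv p₂ x = 0)
    (heq₄ : ∀ x ∈ Ioo (0:ℝ) 1, deriv u₂ x = p₁ x - p₂ x) :
    ∀ x ∈ Ioo (0:ℝ) 1,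
      DifferentiableAt ℝ (fun y => p₂ y - p₁ y) x ∧
      DifferentiableAt ℝ (deriv (fun y => p₂ y - p₁ y)) x ∧
      deriv (deriv (fun y => p₂ y - p₁ y)) x = η ^ 2 * (p₂ x - p₁ x) := by
  intro x hx
  have hη_sq : η ^ 2 = μ * (k₁ + k₂) / (k₁ * k₂) := by
    rw [hη, Real.sq_sqrt (by positivity)]
  have hχ' : ∀ y ∈ Ioo (0:ℝ) 1,
      deriv (fun y => p₂ y - p₁ y) y = μ / k₁ * u₁ y - μ / k₂ * u₂ y := fun y hy => by
    rw [deriv_fun_sub (hp₂ y hy) (hp₁ y hy)]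
    linarith [heq₁ y hy, heq₃ y hy]
  have hχ'' : HasDerivAt (deriv (fun y => p₂ y - p₁ y)) (η ^ 2 * (p₂ x - p₁ x)) x := by
    have h := ((hu₁ x hx).hasDerivAt.const_mul (μ / k₁)).fun_sub
      ((hu₂ x hx).hasDerivAt.const_mul (μ / k₂))
    refine (h.congr_of_eventuallyEq
      (Filter.eventuallyEq_of_mem (isOpen_Ioo.mem_nhds hx) hχ')).congr_deriv ?_
    rw [heq₂ x hx, heq₄ x hx, hη_sq]
    field_simp
    ring
  exact ⟨(hp₂ x hx).fun_sub (hp₁ x hx), hχ''.differentiableAt, hχ''.deriv⟩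
end

section
/- Fix μ, k₁, k₂ > 0, set η := √(μ(k₁+k₂)/(k₁k₂)), let p₂ᴸ, p₂ᴿ be real numbers, and define C₁ := (p₂ᴿ + (1 - p₂ᴸ)·e^{-η})/(e^{η} - e^{-η}) and C₂ := -(p₂ᴿ + (1 - p₂ᴸ)·e^{η})/(e^{η} - e^{-η}). Define, for x ∈ ℝ: p₁(x) := 1 - x - (μ/(k₁η²))·[(1 - p₂ᴸ)(1 - x) - p₂ᴿ·x + C₁e^{ηx} + C₂e^{-ηx}]; p₂(x) := p₂ᴸ(1 - x) + p₂ᴿ·x + (μ/(k₂η²))·[(1 - p₂ᴸ)(1 - x) - p₂ᴿ·x + C₁e^{ηx} + C₂e^{-ηx}]; u₁(x) := k₁/μ + (1/η²)(p₂ᴸ - p₂ᴿ - 1) + (1/η)(C₁e^{ηx} - C₂e^{-ηx}); u₂(x) := (k₂/μ)(p₂ᴸ - p₂ᴿ) - (1/η²)(p₂ᴸ - p₂ᴿ - 1) - (1/η)(C₁e^{ηx} - C₂e^{-ηx}). Then (u₁, u₂, p₁, p₂) satisfies the non-dimensional one-dimensional double porosity/permeability system on (0,1), together with the boundary conditions p₁(0)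 = 1, p₁(1) = 0, p₂(0) = p₂ᴸ, and p₂(1) = p₂ᴿ. -/
open Set

/-- The explicit fields `(u₁, u₂, p₁, p₂)` built from the constants
`C₁, C₂` solve the non-dimensional one-dimensional double porosity/permeability
system on `(0,1)` with boundary conditions `p₁(0) = 1`, `p₁(1) = 0`, `p₂(0) = p₂ᴸ`,
`p₂(1) = p₂ᴿ`. -/
theorem analytical_solution_problem_one
    (μ k₁ k₂ η : ℝ) (hμ : 0 < μ) (hk₁ : 0 < k₁) (hk₂ : 0 < k₂)
    (hη : η = Real.sqrt (μ * (k₁ + k₂) / (k₁ * k₂)))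
    (p₂L p₂R C₁ C₂ : ℝ)
    (hC₁ : C₁ = (p₂R + (1 - p₂L) * Real.exp (-η)) / (Real.exp η - Real.exp (-η)))
    (hC₂ : C₂ = -((p₂R + (1 - p₂L) * Real.exp η) / (Real.exp η - Real.exp (-η))))
    (p₁ p₂ u₁ u₂ : ℝ → ℝ)
    (hp₁ : ∀ x, p₁ x = 1 - x - μ / (k₁ * η ^ 2) *
      ((1 - p₂L) * (1 - x) - p₂R * x + C₁ * Real.exp (η * x) + C₂ * Real.exp (-(η * x))))
    (hp₂ : ∀ x, p₂ x = p₂L * (1 - x) + p₂R * x + μ / (k₂ * η ^ 2) *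
      ((1 - p₂L) * (1 - x) - p₂R * x + C₁ * Real.exp (η * x) + C₂ * Real.exp (-(η * x))))
    (hu₁ : ∀ x, u₁ x = k₁ / μ + 1 / η ^ 2 * (p₂L - p₂R - 1)
      + 1 / η * (C₁ * Real.exp (η * x) - C₂ * Real.exp (-(η * x))))
    (hu₂ : ∀ x, u₂ x = k₂ / μ * (p₂L - p₂R) - 1 / η ^ 2 * (p₂L - p₂R - 1)
      - 1 / η * (C₁ * Real.exp (η * x) - C₂ * Real.exp (-(η * x)))) :
    (∀ x ∈ Ioo (0:ℝ) 1,
      DifferentiableAt ℝ u₁ x ∧ DifferentiableAt ℝ u₂ x ∧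
      DifferentiableAt ℝ p₁ x ∧ DifferentiableAt ℝ p₂ x ∧
      μ / k₁ * u₁ x + deriv p₁ x = 0 ∧
      deriv u₁ x = -(p₁ x - p₂ x) ∧
      μ / k₂ * u₂ x + deriv p₂ x = 0 ∧
      deriv u₂ x = p₁ x - p₂ x) ∧
    p₁ 0 = 1 ∧ p₁ 1 = 0 ∧ p₂ 0 = p₂L ∧ p₂ 1 = p₂R := by
  have hη_pos : 0 < η := by rw [hη]; positivity
  have hη₀ : η ≠ 0 := hη_pos.ne'
  have hη_sq : η ^ 2 = μ * (k₁ + k₂) / (k₁ * k₂) := by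
    rw [hη, Real.sq_sqrt (by positivity)]
  have hweights : μ / (k₁ * η ^ 2) + μ / (k₂ * η ^ 2) = 1 := by
    rw [hη_sq]
    field_simp
    ring
  have hD : Real.exp η - Real.exp (-η) ≠ 0 :=
    (sub_pos.2 (Real.exp_lt_exp.2 (by linarith))).ne'
  have hsum₀ : C₁ + C₂ = -(1 - p₂L) := by
    rw [hC₁, hC₂]
    field_simp
    ring
  have hsum₁ : C₁ * Real.exp η + C₂ * Real.exp (-η) = p₂R := by
    rw [hC₁, hC₂]
    field_simp
    ring
  have hexp (x : ℝ) : HasDerivAt (fun y ↦ Real.exp (η * y)) (η * Real.exp (η * x)) x := by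
    simpa [mul_comm] using ((hasDerivAt_id x).const_mul η).exp
  have hexp_neg (x : ℝ) :
      HasDerivAt (fun y ↦ Real.exp (-(η * y))) (-η * Real.exp (-(η * x))) x := by
    simpa [mul_comm] using ((hasDerivAt_id x).const_mul η).neg.exp
  have hlin (a b x : ℝ) : HasDerivAt (fun y : ℝ ↦ a * (1 - y) + b * y) (b - a) x := by
    refine ((((hasDerivAt_id' x).const_sub 1).const_mul a).add
      ((hasDerivAt_id' x).const_mul b)).congr_deriv ?_
    ring
  have hcomb (c₁ c₂ x : ℝ) :
      HasDerivAt (fun y ↦ c₁ * Real.exp (η * y) + c₂ * Real.exp (-(η * y)))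
        (η * (c₁ * Real.exp (η * x) - c₂ * Real.exp (-(η * x)))) x := by
    refine (((hexp x).const_mul c₁).add ((hexp_neg x).const_mul c₂)).congr_deriv ?_
    ring
  have hdu₁ (x : ℝ) :
      HasDerivAt u₁ (C₁ * Real.exp (η * x) + C₂ * Real.exp (-(η * x))) x := by
    refine ((((hcomb C₁ (-C₂) x).const_mul (1 / η)).const_add
      (k₁ / μ + 1 / η ^ 2 * (p₂L - p₂R - 1))).congr_deriv
        ?_).congr_of_eventuallyEq (.of_forall fun y ↦ ?_)
    · field_simp
      ring
    · rw [hu₁]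
      ring
  have hdu₂ (x : ℝ) :
      HasDerivAt u₂ (-(C₁ * Real.exp (η * x) + C₂ * Real.exp (-(η * x)))) x := by
    refine ((((hcomb C₁ (-C₂) x).const_mul (1 / η)).const_sub
      (k₂ / μ * (p₂L - p₂R) - 1 / η ^ 2 * (p₂L - p₂R - 1))).congr_deriv
        ?_).congr_of_eventuallyEq (.of_forall fun y ↦ ?_)
    · field_simp
      ring
    · rw [hu₂]
      ring
  have hdp₁ (x : ℝ) : HasDerivAt p₁ (-(μ / k₁ * u₁ x)) x := by
    refine (((hlin 1 0 x).sub (((hlin (1 - p₂L) (-p₂R) x).add (hcomb C₁ C₂ x)).const_mul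
      (μ / (k₁ * η ^ 2)))).congr_deriv
        ?_).congr_of_eventuallyEq (.of_forall fun y ↦ ?_)
    · rw [hu₁]
      field_simp
      ring
    · simp only [hp₁, Pi.sub_apply, Pi.add_apply]
      ring
  have hdp₂ (x : ℝ) : HasDerivAt p₂ (-(μ / k₂ * u₂ x)) x := by
    refine (((hlin p₂L p₂R x).add (((hlin (1 - p₂L) (-p₂R) x).add (hcomb C₁ C₂ x)).const_mul
      (μ / (k₂ * η ^ 2)))).congr_deriv
        ?_).congr_of_eventuallyEq (.of_forall fun y ↦ ?_)
    · rw [hu₂]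
      field_simp
      ring
    · simp only [hp₂, Pi.add_apply]
      ring
  have hdiff (x : ℝ) :
      p₁ x - p₂ x = -(C₁ * Real.exp (η * x) + C₂ * Real.exp (-(η * x))) := by
    rw [hp₁, hp₂]
    linear_combination (-((1 - p₂L) * (1 - x) - p₂R * x + C₁ * Real.exp (η * x) +
      C₂ * Real.exp (-(η * x)))) * hweights
  refine ⟨fun x _ ↦ ⟨(hdu₁ x).differentiableAt, (hdu₂ x).differentiableAt,
    (hdp₁ x).differentiableAt, (hdp₂ x).differentiableAt, ?_, ?_, ?_, ?_⟩, ?_, ?_, ?_, ?_⟩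
  · rw [(hdp₁ x).deriv, add_neg_cancel]
  · rw [(hdu₁ x).deriv, hdiff, neg_neg]
  · rw [(hdp₂ x).deriv, add_neg_cancel]
  · rw [(hdu₂ x).deriv, hdiff]
  · rw [hp₁, mul_zero η, neg_zero, Real.exp_zero]
    linear_combination (-(μ / (k₁ * η ^ 2))) * hsum₀
  · rw [hp₁, mul_one η]
    linear_combination (-(μ / (k₁ * η ^ 2))) * hsum₁
  · rw [hp₂, mul_zero η, neg_zero, Real.exp_zero]
    linear_combination (μ / (k₂ * η ^ 2)) * hsum₀
  · rw [hp₂, mul_one η]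
    linear_combination (μ / (k₂ * η ^ 2)) * hsum₁
end

section
/- Uniqueness for the pressure-prescribed boundary value problem: if (u₁, u₂, p₁, p₂) and (u₁*, u₂*, p₁*, p₂*) are two quadruples of functions, each continuous on [0,1], differentiable on (0,1), satisfying the non-dimensional one-dimensional double porosity/permeability system on (0,1), and if p₁(0) = p₁*(0), p₁(1) = p₁*(1), p₂(0) = p₂*(0), and p₂(1) = p₂*(1), then u₁ = u₁*, u₂ = u₂*, p₁ = p₁*, and p₂ = p₂* on all of [0,1]. -/
open Set

theorem eq_left_of_hasDerivAt_nonpos_of_eq {f f' : ℝ → ℝ} {a b : ℝ}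
    (hc : ContinuousOn f (Icc a b)) (hd : ∀ x ∈ Ioo a b, HasDerivAt f (f' x) x)
    (hf' : ∀ x ∈ Ioo a b, f' x ≤ 0) (hab : f a = f b) :
    ∀ x ∈ Icc a b, f x = f a := by
  intro x hx
  have hle : a ≤ b := hx.1.trans hx.2
  have hanti : AntitoneOn f (Icc a b) := by
    refine antitoneOn_of_deriv_nonpos (convex_Icc a b) hc ?_ ?_ <;> rw [interior_Icc]
    · exact fun y hy => (hd y hy).differentiableAt.differentiableWithinAt
    · exact fun y hy => (hd y hy).deriv ▸ hf' y hy
  exact le_antisymm (hanti (left_mem_Icc.2 hle) hx hx.1)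
    (hab ▸ hanti hx (right_mem_Icc.2 hle) hx.2)

theorem hasDerivAt_eq_zero_of_nonpos_of_eq {f f' : ℝ → ℝ} {a b : ℝ}
    (hc : ContinuousOn f (Icc a b)) (hd : ∀ x ∈ Ioo a b, HasDerivAt f (f' x) x)
    (hf' : ∀ x ∈ Ioo a b, f' x ≤ 0) (hab : f a = f b) :
    ∀ x ∈ Ioo a b, f' x = 0 := by
  intro x hx
  have hconst : f =ᶠ[nhds x] fun _ => f a := by
    filter_upwards [Icc_mem_nhds hx.1 hx.2] with y hy
    exact eq_left_of_hasDerivAt_nonpos_of_eq hc hd hf' hab y hy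
  exact (hd x hx).unique ((hasDerivAt_const x (f a)).congr_of_eventuallyEq hconst)

/-- The homogeneous pressure-prescribed problem has only the trivial solution: the energy
`u₁ p₁ + u₂ p₂` vanishes at both endpoints and its derivative
`-((p₁ - p₂)² + α u₁² + β u₂²)` is nonpositive. -/
theorem double_porosity_eq_zero_of_pressure_eq_zero {α β : ℝ} (hα : 0 < α) (hβ : 0 < β)
    {a b : ℝ} (hab : a < b) {u₁ u₂ p₁ p₂ : ℝ → ℝ}
    (hcu₁ : ContinuousOn u₁ (Icc a b)) (hcu₂ : ContinuousOn u₂ (Icc a b))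
    (hcp₁ : ContinuousOn p₁ (Icc a b)) (hcp₂ : ContinuousOn p₂ (Icc a b))
    (hp₁ : ∀ x ∈ Ioo a b, HasDerivAt p₁ (-(α * u₁ x)) x)
    (hu₁ : ∀ x ∈ Ioo a b, HasDerivAt u₁ (-(p₁ x - p₂ x)) x)
    (hp₂ : ∀ x ∈ Ioo a b, HasDerivAt p₂ (-(β * u₂ x)) x)
    (hu₂ : ∀ x ∈ Ioo a b, HasDerivAt u₂ (p₁ x - p₂ x) x)
    (hp₁a : p₁ a = 0) (hp₁b : p₁ b = 0) (hp₂a : p₂ a = 0) (hp₂b : p₂ b = 0) :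
    ∀ x ∈ Icc a b, u₁ x = 0 ∧ u₂ x = 0 ∧ p₁ x = 0 ∧ p₂ x = 0 := by
  have henergy : ∀ x ∈ Ioo a b, -((p₁ x - p₂ x) ^ 2 + α * u₁ x ^ 2 + β * u₂ x ^ 2) = 0 := by
    refine hasDerivAt_eq_zero_of_nonpos_of_eq (f := fun x => u₁ x * p₁ x + u₂ x * p₂ x)
      ((hcu₁.mul hcp₁).add (hcu₂.mul hcp₂)) (fun x hx => ?_) (fun x _ => ?_) ?_
    · refine (((hu₁ x hx).mul (hp₁ x hx)).add ((hu₂ x hx).mul (hp₂ x hx))).congr_deriv ?_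
      ring
    · rw [neg_nonpos]
      positivity
    · simp [hp₁a, hp₁b, hp₂a, hp₂b]
  have hu₁0 : EqOn u₁ (fun _ => 0) (Ioo a b) := fun x hx => by
    have h : α * u₁ x ^ 2 = 0 := by
      have h₁ : 0 ≤ α * u₁ x ^ 2 := by positivity
      have h₂ : 0 ≤ β * u₂ x ^ 2 := by positivity
      linarith [henergy x hx, sq_nonneg (p₁ x - p₂ x)]
    simpa [hα.ne'] using h
  have hu₂0 : EqOn u₂ (fun _ => 0) (Ioo a b) := fun x hx => by
    have h : β * u₂ x ^ 2 = 0 := by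
      have h₁ : 0 ≤ α * u₁ x ^ 2 := by positivity
      have h₂ : 0 ≤ β * u₂ x ^ 2 := by positivity
      linarith [henergy x hx, sq_nonneg (p₁ x - p₂ x)]
    simpa [hβ.ne'] using h
  have hcl : Icc a b ⊆ closure (Ioo a b) := (closure_Ioo hab.ne).ge
  refine fun x hx => ⟨hu₁0.of_subset_closure hcu₁ continuousOn_const Ioo_subset_Icc_self hcl hx,
    hu₂0.of_subset_closure hcu₂ continuousOn_const Ioo_subset_Icc_self hcl hx, ?_, ?_⟩
  · rw [← hp₁a]
    exact eq_left_of_hasDerivAt_nonpos_of_eq hcp₁ hp₁ (fun y hy => by simp [hu₁0 hy])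
      (hp₁a.trans hp₁b.symm) x hx
  · rw [← hp₂a]
    exact eq_left_of_hasDerivAt_nonpos_of_eq hcp₂ hp₂ (fun y hy => by simp [hu₂0 hy])
      (hp₂a.trans hp₂b.symm) x hx

/-- Uniqueness for the pressure-prescribed boundary value problem of the
non-dimensional one-dimensional double porosity/permeability system on `(0,1)`. -/
theorem uniqueness_pressure_bc
    (μ k₁ k₂ : ℝ) (hμ : 0 < μ) (hk₁ : 0 < k₁) (hk₂ : 0 < k₂)
    (u₁ u₂ p₁ p₂ u₁' u₂' p₁' p₂' : ℝ → ℝ)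
    (hcont : ∀ f ∈ [u₁, u₂, p₁, p₂, u₁', u₂', p₁', p₂'], ContinuousOn f (Icc 0 1))
    (hdiff : ∀ f ∈ [u₁, u₂, p₁, p₂, u₁', u₂', p₁', p₂'],
      ∀ x ∈ Ioo (0:ℝ) 1, DifferentiableAt ℝ f x)
    (heq₁ : ∀ x ∈ Ioo (0:ℝ) 1, μ / k₁ * u₁ x + deriv p₁ x = 0)
    (heq₂ : ∀ x ∈ Ioo (0:ℝ) 1, deriv u₁ x = -(p₁ x - p₂ x))
    (heq₃ : ∀ x ∈ Ioo (0:ℝ) 1, μ / k₂ * u₂ x + deriv p₂ x = 0)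
    (heq₄ : ∀ x ∈ Ioo (0:ℝ) 1, deriv u₂ x = p₁ x - p₂ x)
    (heq₁' : ∀ x ∈ Ioo (0:ℝ) 1, μ / k₁ * u₁' x + deriv p₁' x = 0)
    (heq₂' : ∀ x ∈ Ioo (0:ℝ) 1, deriv u₁' x = -(p₁' x - p₂' x))
    (heq₃' : ∀ x ∈ Ioo (0:ℝ) 1, μ / k₂ * u₂' x + deriv p₂' x = 0)
    (heq₄' : ∀ x ∈ Ioo (0:ℝ) 1, deriv u₂' x = p₁' x - p₂' x)
    (hbc₁ : p₁ 0 = p₁' 0) (hbc₂ : p₁ 1 = p₁' 1)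
    (hbc₃ : p₂ 0 = p₂' 0) (hbc₄ : p₂ 1 = p₂' 1) :
    ∀ x ∈ Icc (0:ℝ) 1,
      u₁ x = u₁' x ∧ u₂ x = u₂' x ∧ p₁ x = p₁' x ∧ p₂ x = p₂' x := by
  simp only [List.forall_mem_cons, List.not_mem_nil, false_imp_iff, implies_true, and_true]
    at hcont hdiff
  obtain ⟨cu₁, cu₂, cp₁, cp₂, cu₁', cu₂', cp₁', cp₂'⟩ := hcont
  obtain ⟨du₁, du₂, dp₁, dp₂, du₁', du₂', dp₁', dp₂'⟩ := hdiff
  intro x hx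
  have h := double_porosity_eq_zero_of_pressure_eq_zero (div_pos hμ hk₁) (div_pos hμ hk₂)
    zero_lt_one (cu₁.sub cu₁') (cu₂.sub cu₂') (cp₁.sub cp₁') (cp₂.sub cp₂')
    (fun y hy => ((dp₁ y hy).hasDerivAt.sub (dp₁' y hy).hasDerivAt).congr_deriv (by
      simp only [Pi.sub_apply]; linarith [heq₁ y hy, heq₁' y hy]))
    (fun y hy => ((du₁ y hy).hasDerivAt.sub (du₁' y hy).hasDerivAt).congr_deriv (by
      simp only [Pi.sub_apply]; linarith [heq₂ y hy, heq₂' y hy]))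
    (fun y hy => ((dp₂ y hy).hasDerivAt.sub (dp₂' y hy).hasDerivAt).congr_deriv (by
      simp only [Pi.sub_apply]; linarith [heq₃ y hy, heq₃' y hy]))
    (fun y hy => ((du₂ y hy).hasDerivAt.sub (du₂' y hy).hasDerivAt).congr_deriv (by
      simp only [Pi.sub_apply]; linarith [heq₄ y hy, heq₄' y hy]))
    (sub_eq_zero.2 hbc₁) (sub_eq_zero.2 hbc₂) (sub_eq_zero.2 hbc₃) (sub_eq_zero.2 hbc₄) x hx
  simpa only [Pi.sub_apply, sub_eq_zero] using h
end

section
/- Uniqueness when velocity conditions are prescribed on the entire boundary of one pore-network: if (u₁, u₂, p₁, p₂) and (u₁*, u₂*, p₁*, p₂*) are two quadruples of functions, each continuous on [0,1], differentiable on (0,1), satisfying the non-dimensional one-dimensional double porosity/permeability system on (0,1), and if p₁(0) = p₁*(0), p₁(1) = p₁*(1), u₂(0) = u₂*(0), and u₂(1) = u₂*(1), then u₁ = u₁*, u₂ = u₂*, p₁ = p₁*, and p₂ = p₂* on all of [0,1]. In particular, the micro-pore pressure p₂ is uniquely determined even though only velocity data are prescribed for the micro-pore network, in contrast with the single-network Darcy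 equations. -/
open Set

/-- A continuous function with nonpositive derivative that vanishes at both endpoints of an
interval vanishes on the interval. -/
theorem eqOn_zero_of_hasDerivAt_nonpos {f f' : ℝ → ℝ} {a b : ℝ}
    (hf : ContinuousOn f (Icc a b)) (hd : ∀ x ∈ Ioo a b, HasDerivAt f (f' x) x)
    (hf' : ∀ x ∈ Ioo a b, f' x ≤ 0) (ha : f a = 0) (hb : f b = 0) :
    EqOn f 0 (Icc a b) := by
  have hanti : AntitoneOn f (Icc a b) := by
    refine antitoneOn_of_deriv_nonpos (convex_Icc a b) hf ?_ ?_ <;> rw [interior_Icc]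
    · exact fun x hx => (hd x hx).differentiableAt.differentiableWithinAt
    · exact fun x hx => (hd x hx).deriv.trans_le (hf' x hx)
  intro x hx
  have hab : a ≤ b := hx.1.trans hx.2
  exact le_antisymm ((hanti (left_mem_Icc.2 hab) hx hx.1).trans_eq ha)
    (hb.symm.trans_le (hanti hx (right_mem_Icc.2 hab) hx.2))

/-- The homogeneous double porosity/permeability system, with zero macro-pressure and zero
micro-velocity at both endpoints, has only the trivial solution. The proof is an energy argument:
`p₁ u₁ + p₂ u₂` has derivative `-(α u₁² + β u₂² + (p₁ - p₂)²)` and vanishes at the endpoints. -/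
theorem double_porosity_eqOn_zero {α β a b : ℝ} (hα : 0 < α) (hβ : 0 < β) (hab : a < b)
    {u₁ u₂ p₁ p₂ : ℝ → ℝ}
    (hu₁ : ContinuousOn u₁ (Icc a b)) (hu₂ : ContinuousOn u₂ (Icc a b))
    (hp₁ : ContinuousOn p₁ (Icc a b)) (hp₂ : ContinuousOn p₂ (Icc a b))
    (du₁ : ∀ x ∈ Ioo a b, HasDerivAt u₁ (-(p₁ x - p₂ x)) x)
    (du₂ : ∀ x ∈ Ioo a b, HasDerivAt u₂ (p₁ x - p₂ x) x)
    (dp₁ : ∀ x ∈ Ioo a b, HasDerivAt p₁ (-(α * u₁ x)) x)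
    (dp₂ : ∀ x ∈ Ioo a b, HasDerivAt p₂ (-(β * u₂ x)) x)
    (hp₁a : p₁ a = 0) (hp₁b : p₁ b = 0) (hu₂a : u₂ a = 0) (hu₂b : u₂ b = 0) :
    EqOn u₁ 0 (Icc a b) ∧ EqOn u₂ 0 (Icc a b) ∧ EqOn p₁ 0 (Icc a b) ∧
      EqOn p₂ 0 (Icc a b) := by
  have dE : ∀ x ∈ Ioo a b, HasDerivAt (fun y => p₁ y * u₁ y + p₂ y * u₂ y)
      (-(α * u₁ x ^ 2 + β * u₂ x ^ 2 + (p₁ x - p₂ x) ^ 2)) x := fun x hx =>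
    (((dp₁ x hx).fun_mul (du₁ x hx)).fun_add ((dp₂ x hx).fun_mul (du₂ x hx))).congr_deriv
      (by ring)
  have hE : EqOn (fun y => p₁ y * u₁ y + p₂ y * u₂ y) 0 (Icc a b) :=
    eqOn_zero_of_hasDerivAt_nonpos ((hp₁.mul hu₁).add (hp₂.mul hu₂)) dE
      (fun x _ => neg_nonpos.2 (by positivity)) (by simp [hp₁a, hu₂a]) (by simp [hp₁b, hu₂b])
  have hzero : ∀ x ∈ Ioo a b, u₁ x = 0 ∧ u₂ x = 0 ∧ p₁ x - p₂ x = 0 := by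
    intro x hx
    have h0 := (dE x hx).unique ((hasDerivAt_const x (0 : ℝ)).congr_of_eventuallyEq
      (hE.eventuallyEq_of_mem (Icc_mem_nhds hx.1 hx.2)))
    have h₁ : 0 ≤ α * u₁ x ^ 2 := by positivity
    have h₂ : 0 ≤ β * u₂ x ^ 2 := by positivity
    have h₃ := sq_nonneg (p₁ x - p₂ x)
    refine ⟨?_, ?_, pow_eq_zero_iff two_ne_zero |>.1 (by linarith)⟩
    · have : α * u₁ x ^ 2 = 0 := by linarith
      simpa [hα.ne'] using this
    · have : β * u₂ x ^ 2 = 0 := by linarith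
      simpa [hβ.ne'] using this
  have hp₁0 : EqOn p₁ 0 (Icc a b) :=
    eqOn_zero_of_hasDerivAt_nonpos hp₁ dp₁ (fun x hx => by simp [(hzero x hx).1]) hp₁a hp₁b
  have hext : ∀ {f : ℝ → ℝ}, ContinuousOn f (Icc a b) → EqOn f 0 (Ioo a b) →
      EqOn f 0 (Icc a b) := fun hf h =>
    h.of_subset_closure hf continuousOn_const Ioo_subset_Icc_self (closure_Ioo hab.ne).ge
  refine ⟨hext hu₁ fun x hx => (hzero x hx).1, hext hu₂ fun x hx => (hzero x hx).2.1, hp₁0,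
    hext hp₂ fun x hx => ?_⟩
  exact (sub_eq_zero.1 (hzero x hx).2.2).symm.trans (hp₁0 (Ioo_subset_Icc_self hx))

/-- Uniqueness for the non-dimensional one-dimensional double
porosity/permeability system on `(0,1)` when pressures are prescribed for the
macro-pore network and velocities are prescribed on the entire boundary of the
micro-pore network. In particular the micro-pressure `p₂` is uniquely determined. -/
theorem uniqueness_velocity_bc_micro
    (μ k₁ k₂ : ℝ) (hμ : 0 < μ) (hk₁ : 0 < k₁) (hk₂ : 0 < k₂)
    (u₁ u₂ p₁ p₂ u₁' u₂' p₁' p₂' : ℝ → ℝ)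
    (hcont : ∀ f ∈ [u₁, u₂, p₁, p₂, u₁', u₂', p₁', p₂'], ContinuousOn f (Icc 0 1))
    (hdiff : ∀ f ∈ [u₁, u₂, p₁, p₂, u₁', u₂', p₁', p₂'],
      ∀ x ∈ Ioo (0:ℝ) 1, DifferentiableAt ℝ f x)
    (heq₁ : ∀ x ∈ Ioo (0:ℝ) 1, μ / k₁ * u₁ x + deriv p₁ x = 0)
    (heq₂ : ∀ x ∈ Ioo (0:ℝ) 1, deriv u₁ x = -(p₁ x - p₂ x))
    (heq₃ : ∀ x ∈ Ioo (0:ℝ) 1, μ / k₂ * u₂ x + deriv p₂ x = 0)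
    (heq₄ : ∀ x ∈ Ioo (0:ℝ) 1, deriv u₂ x = p₁ x - p₂ x)
    (heq₁' : ∀ x ∈ Ioo (0:ℝ) 1, μ / k₁ * u₁' x + deriv p₁' x = 0)
    (heq₂' : ∀ x ∈ Ioo (0:ℝ) 1, deriv u₁' x = -(p₁' x - p₂' x))
    (heq₃' : ∀ x ∈ Ioo (0:ℝ) 1, μ / k₂ * u₂' x + deriv p₂' x = 0)
    (heq₄' : ∀ x ∈ Ioo (0:ℝ) 1, deriv u₂' x = p₁' x - p₂' x)
    (hbc₁ : p₁ 0 = p₁' 0) (hbc₂ : p₁ 1 = p₁' 1)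
    (hbc₃ : u₂ 0 = u₂' 0) (hbc₄ : u₂ 1 = u₂' 1) :
    ∀ x ∈ Icc (0:ℝ) 1,
      u₁ x = u₁' x ∧ u₂ x = u₂' x ∧ p₁ x = p₁' x ∧ p₂ x = p₂' x := by
  simp only [List.forall_mem_cons] at hcont hdiff
  obtain ⟨cu₁, cu₂, cp₁, cp₂, cu₁', cu₂', cp₁', cp₂', -⟩ := hcont
  obtain ⟨du₁, du₂, dp₁, dp₂, du₁', du₂', dp₁', dp₂', -⟩ := hdiff
  have hsub : ∀ {f g : ℝ → ℝ} {x c : ℝ}, DifferentiableAt ℝ f x → DifferentiableAt ℝ g x →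
      deriv f x - deriv g x = c → HasDerivAt (f - g) c x := fun hf hg h =>
    (hf.hasDerivAt.sub hg.hasDerivAt).congr_deriv h
  obtain ⟨h₁, h₂, h₃, h₄⟩ := double_porosity_eqOn_zero (div_pos hμ hk₁) (div_pos hμ hk₂)
    zero_lt_one (cu₁.sub cu₁') (cu₂.sub cu₂') (cp₁.sub cp₁') (cp₂.sub cp₂')
    (fun x hx => hsub (du₁ x hx) (du₁' x hx) (by
      simp only [Pi.sub_apply]; linarith [heq₂ x hx, heq₂' x hx]))
    (fun x hx => hsub (du₂ x hx) (du₂' x hx) (by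
      simp only [Pi.sub_apply]; linarith [heq₄ x hx, heq₄' x hx]))
    (fun x hx => hsub (dp₁ x hx) (dp₁' x hx) (by
      simp only [Pi.sub_apply]; linarith [heq₁ x hx, heq₁' x hx]))
    (fun x hx => hsub (dp₂ x hx) (dp₂' x hx) (by
      simp only [Pi.sub_apply]; linarith [heq₃ x hx, heq₃' x hx]))
    (sub_eq_zero.2 hbc₁) (sub_eq_zero.2 hbc₂) (sub_eq_zero.2 hbc₃) (sub_eq_zero.2 hbc₄)
  exact fun x hx => ⟨sub_eq_zero.1 (h₁ hx), sub_eq_zero.1 (h₂ hx), sub_eq_zero.1 (h₃ hx),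
    sub_eq_zero.1 (h₄ hx)⟩
end

section
/- Reduction to a diffusion equation with decay: let Ω ⊆ ℝⁿ be open, let μ, β, k₁, k₂ > 0 and γ ∈ ℝ be constants, let b : ℝⁿ → ℝⁿ be differentiable on Ω, let p₁, p₂ : ℝⁿ → ℝ be twice continuously differentiable on Ω, and let u₁, u₂ : ℝⁿ → ℝⁿ be differentiable on Ω, such that for all x ∈ Ω: (μ/k₁)·u₁(x) + ∇p₁(x) = γ·b(x); (μ/k₂)·u₂(x) + ∇p₂(x) = γ·b(x); div u₁(x) = -(β/μ)(p₁(x) - p₂(x)); div u₂(x) = (β/μ)(p₁(x) - p₂(x)). Then the pressure difference satisfies β·(1/k₁ + 1/k₂)·(p₁(x) - p₂(x)) - Δ(p₁ - p₂)(x) = 0 for all x ∈ Ω, where Δf denotes the Laplacian of f (the sum of the n second partial derivatives, i.e., the trace of the second Fréchet derivative), ∇ the gradient, and div F the trace of the Fréchet derivative of the vector field F. -/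
open Set

/-- The divergence of a vector field on `ℝⁿ`: the trace of its Fréchet derivative,
computed as the sum of the diagonal entries in the standard basis. -/
noncomputable def vectorDivergence {n : ℕ}
    (F : EuclideanSpace ℝ (Fin n) → EuclideanSpace ℝ (Fin n))
    (x : EuclideanSpace ℝ (Fin n)) : ℝ :=
  ∑ i, fderiv ℝ F x (EuclideanSpace.single i 1) i

/-- The Laplacian of a scalar field on `ℝⁿ`: the trace of its second Fréchet derivative,
i.e. the sum of its `n` pure second partial derivatives. -/
noncomputable def scalarLaplacian {n : ℕ}
    (f : EuclideanSpace ℝ (Fin n) → ℝ)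
    (x : EuclideanSpace ℝ (Fin n)) : ℝ :=
  ∑ i, fderiv ℝ (fun y => fderiv ℝ f y (EuclideanSpace.single i 1)) x
    (EuclideanSpace.single i 1)

/-- The partial derivatives of a scalar field are the coordinates of its gradient. -/
lemma gradient_apply_eq_fderiv_single {n : ℕ} (f : EuclideanSpace ℝ (Fin n) → ℝ)
    (x : EuclideanSpace ℝ (Fin n)) (i : Fin n) :
    gradient f x i = fderiv ℝ f x (EuclideanSpace.single i 1) := by
  rw [← inner_gradient_left, EuclideanSpace.inner_single_right]
  simp

/-- The Laplacian is the divergence of the gradient. -/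
lemma scalarLaplacian_eq_vectorDivergence {n : ℕ} {f : EuclideanSpace ℝ (Fin n) → ℝ}
    {F : EuclideanSpace ℝ (Fin n) → EuclideanSpace ℝ (Fin n)} {x : EuclideanSpace ℝ (Fin n)}
    (hf : gradient f =ᶠ[nhds x] F) (hF : DifferentiableAt ℝ F x) :
    scalarLaplacian f x = vectorDivergence F x := by
  refine Finset.sum_congr rfl fun i _ => ?_
  have hi : (fun y => fderiv ℝ f y (EuclideanSpace.single i 1)) =ᶠ[nhds x] fun y => F y i := by
    filter_upwards [hf] with y hy
    rw [← gradient_apply_eq_fderiv_single, hy]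
  rw [hi.fderiv_eq]
  have hcoord : HasFDerivAt (fun y => F y i) ((EuclideanSpace.proj i).comp (fderiv ℝ F x)) x :=
    (EuclideanSpace.proj (𝕜 := ℝ) i).hasFDerivAt.comp x hF.hasFDerivAt
  rw [hcoord.fderiv]
  rfl

lemma vectorDivergence_sub {n : ℕ}
    {F G : EuclideanSpace ℝ (Fin n) → EuclideanSpace ℝ (Fin n)} {x : EuclideanSpace ℝ (Fin n)}
    (hF : DifferentiableAt ℝ F x) (hG : DifferentiableAt ℝ G x) :
    vectorDivergence (F - G) x = vectorDivergence F x - vectorDivergence G x := by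
  simp [vectorDivergence, fderiv_sub hF hG]

lemma vectorDivergence_smul {n : ℕ}
    {F : EuclideanSpace ℝ (Fin n) → EuclideanSpace ℝ (Fin n)} {x : EuclideanSpace ℝ (Fin n)}
    (c : ℝ) (hF : DifferentiableAt ℝ F x) :
    vectorDivergence (c • F) x = c * vectorDivergence F x := by
  simp [vectorDivergence, fderiv_const_smul hF, Finset.mul_sum]

lemma gradient_sub_apply {n : ℕ} {f g : EuclideanSpace ℝ (Fin n) → ℝ}
    {x : EuclideanSpace ℝ (Fin n)}
    (hf : DifferentiableAt ℝ f x) (hg : DifferentiableAt ℝ g x) :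
    gradient (fun y => f y - g y) x = gradient f x - gradient g x := by
  simp [gradient, fderiv_fun_sub hf hg]

/-- For solutions of the double porosity/permeability model with isotropic
homogeneous permeabilities on an open set `Ω ⊆ ℝⁿ`, the pressure difference satisfies the
diffusion equation with decay `β(1/k₁ + 1/k₂)(p₁ - p₂) - Δ(p₁ - p₂) = 0` on `Ω`. -/
theorem pressure_difference_diffusion_with_decay {n : ℕ}
    (Ω : Set (EuclideanSpace ℝ (Fin n))) (hΩ : IsOpen Ω)
    (μ β k₁ k₂ γ : ℝ) (hμ : 0 < μ) (hβ : 0 < β) (hk₁ : 0 < k₁) (hk₂ : 0 < k₂)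
    (b u₁ u₂ : EuclideanSpace ℝ (Fin n) → EuclideanSpace ℝ (Fin n))
    (p₁ p₂ : EuclideanSpace ℝ (Fin n) → ℝ)
    (hb : DifferentiableOn ℝ b Ω)
    (hp₁ : ContDiffOn ℝ 2 p₁ Ω) (hp₂ : ContDiffOn ℝ 2 p₂ Ω)
    (hu₁ : DifferentiableOn ℝ u₁ Ω) (hu₂ : DifferentiableOn ℝ u₂ Ω)
    (heq₁ : ∀ x ∈ Ω, (μ / k₁) • u₁ x + gradient p₁ x = γ • b x)
    (heq₂ : ∀ x ∈ Ω, (μ / k₂) • u₂ x + gradient p₂ x = γ • b x)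
    (heq₃ : ∀ x ∈ Ω, vectorDivergence u₁ x = -(β / μ) * (p₁ x - p₂ x))
    (heq₄ : ∀ x ∈ Ω, vectorDivergence u₂ x = (β / μ) * (p₁ x - p₂ x)) :
    ∀ x ∈ Ω,
      β * (1 / k₁ + 1 / k₂) * (p₁ x - p₂ x)
        - scalarLaplacian (fun y => p₁ y - p₂ y) x = 0 := by
  intro x hx
  have hΩx : Ω ∈ nhds x := hΩ.mem_nhds hx
  have hd₁ := hu₁.differentiableAt hΩx
  have hd₂ := hu₂.differentiableAt hΩx
  have hgrad : gradient (fun y => p₁ y - p₂ y) =ᶠ[nhds x]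
      (μ / k₂) • u₂ - (μ / k₁) • u₁ := by
    filter_upwards [hΩx] with y hy
    have hΩy := hΩ.mem_nhds hy
    rw [gradient_sub_apply ((hp₁.contDiffAt hΩy).differentiableAt two_ne_zero)
      ((hp₂.contDiffAt hΩy).differentiableAt two_ne_zero),
      eq_sub_of_add_eq' (heq₁ y hy), eq_sub_of_add_eq' (heq₂ y hy)]
    simp only [Pi.sub_apply, Pi.smul_apply]
    abel
  rw [scalarLaplacian_eq_vectorDivergence hgrad ((hd₂.const_smul _).sub (hd₁.const_smul _)),
    vectorDivergence_sub (hd₂.const_smul _) (hd₁.const_smul _), vectorDivergence_smul _ hd₂,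
    vectorDivergence_smul _ hd₁, heq₃ x hx, heq₄ x hx]
  field_simp
  ring
end

section
/- Maximum principle for the double porosity/permeability model (isotropic homogeneous permeabilities): let Ω be a non-empty bounded open subset of ℝⁿ, let μ, β, k₁, k₂ > 0 and γ ∈ ℝ be constants, let b : ℝⁿ → ℝⁿ be differentiable on Ω, let p₁, p₂ : ℝⁿ → ℝ be continuous on the closure of Ω and twice continuously differentiable on Ω, and let u₁, u₂ : ℝⁿ → ℝⁿ be differentiable on Ω, such that for all x ∈ Ω: (μ/k₁)·u₁(x) + ∇p₁(x) = γ·b(x); (μ/k₂)·u₂(x) + ∇p₂(x) = γ·b(x); div u₁(x) = -(β/μ)(p₁(x) - p₂(x)); div u₂(x) = (β/μ)(p₁(x) - p₂(x)). Then for every x in the closure of Ω: min(0, inf_{y ∈ ∂Ω} (p₁(y) - p₂(y))) ≤ p₁(x) - p₂(x) ≤ max(0, sup_{y ∈ ∂Ω} (p₁(y) - p₂(y))), where ∂Ω denotes the topological frontier of Ω. -/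
open Set

/-- Necessary second-order condition: the second derivative is non-positive at a local maximum. -/
theorem deriv_deriv_nonpos_of_isLocalMax {f : ℝ → ℝ} {a : ℝ} (h : IsLocalMax f a)
    (hf : ContinuousAt f a) : deriv (deriv f) a ≤ 0 := by
  by_contra! hpos
  have hmin : IsLocalMin f a := isLocalMin_of_deriv_deriv_pos hpos h.deriv_eq_zero hf
  have hconst : f =ᶠ[nhds a] fun _ => f a := by
    filter_upwards [h, hmin] with y h₁ h₂ using le_antisymm h₁ h₂
  have hzero : deriv (deriv f) a = 0 := by
    rw [hconst.deriv.deriv_eq]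
    simp
  exact hpos.ne' hzero

/-- The divergence of the gradient of a function is non-positive at a local maximum. -/
theorem vectorDivergence_nonpos_of_isLocalMax {n : ℕ} {w : EuclideanSpace ℝ (Fin n) → ℝ}
    {V : EuclideanSpace ℝ (Fin n) → EuclideanSpace ℝ (Fin n)} {x : EuclideanSpace ℝ (Fin n)}
    (hw : ∀ᶠ y in nhds x, HasGradientAt w (V y) y) (hV : DifferentiableAt ℝ V x)
    (hmax : IsLocalMax w x) : vectorDivergence V x ≤ 0 := by
  refine Finset.sum_nonpos fun i _ => ?_
  set e : EuclideanSpace ℝ (Fin n) := EuclideanSpace.single i 1 with he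
  have hline (t : ℝ) : HasDerivAt (fun s : ℝ => x + s • e) e t := by
    simpa using ((hasDerivAt_id t).smul_const e).const_add x
  have hline_tendsto : Filter.Tendsto (fun s : ℝ => x + s • e) (nhds 0) (nhds x) := by
    simpa using (hline 0).continuousAt.tendsto
  have hderiv : ∀ᶠ t in nhds (0 : ℝ), HasDerivAt (fun s : ℝ => w (x + s • e)) (V (x + t • e) i) t := by
    filter_upwards [hline_tendsto.eventually hw] with t ht
    have h := ht.hasFDerivAt.comp_hasDerivAt t (hline t)
    simpa [he, Function.comp_def, EuclideanSpace.inner_single_right] using h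
  have hVline : HasDerivAt (fun t : ℝ => V (x + t • e) i) (fderiv ℝ V x e i) 0 := by
    have hV0 : HasFDerivAt V (fderiv ℝ V x) (x + (0 : ℝ) • e) := by simpa using hV.hasFDerivAt
    have h := hV0.comp_hasDerivAt 0 (hline 0)
    exact (EuclideanSpace.proj (𝕜 := ℝ) i).hasFDerivAt.comp_hasDerivAt 0 h
  have hsecond : deriv (deriv fun s : ℝ => w (x + s • e)) 0 = fderiv ℝ V x e i := by
    have : deriv (fun s : ℝ => w (x + s • e)) =ᶠ[nhds 0] fun t => V (x + t • e) i := by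
      filter_upwards [hderiv] with t ht using ht.deriv
    rw [this.deriv_eq, hVline.deriv]
  rw [← hsecond]
  refine deriv_deriv_nonpos_of_isLocalMax ?_ hderiv.self_of_nhds.continuousAt
  have := hline_tendsto.eventually hmax
  simpa [IsLocalMax, IsMaxFilter] using this

/-- Weak maximum principle for solutions of `Δ w = c w` with `c > 0`, where `V` is the gradient
of `w`. -/
theorem le_max_zero_sSup_frontier_of_vectorDivergence_eq {n : ℕ}
    {Ω : Set (EuclideanSpace ℝ (Fin n))} (hΩ : IsOpen Ω) (hbd : Bornology.IsBounded Ω)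
    {w : EuclideanSpace ℝ (Fin n) → ℝ} {V : EuclideanSpace ℝ (Fin n) → EuclideanSpace ℝ (Fin n)}
    {c : ℝ} (hc : 0 < c) (hwc : ContinuousOn w (closure Ω))
    (hw : ∀ x ∈ Ω, HasGradientAt w (V x) x) (hV : DifferentiableOn ℝ V Ω)
    (hdiv : ∀ x ∈ Ω, vectorDivergence V x = c * w x) {x : EuclideanSpace ℝ (Fin n)}
    (hx : x ∈ closure Ω) : w x ≤ max 0 (sSup (w '' frontier Ω)) := by
  have hcomp : IsCompact (closure Ω) := hbd.isCompact_closure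
  obtain ⟨z, hz, hzmax⟩ := hcomp.exists_isMaxOn ⟨x, hx⟩ hwc
  refine (hzmax hx).trans ?_
  by_cases hzΩ : z ∈ Ω
  · have hnhds := hΩ.mem_nhds hzΩ
    have hle := vectorDivergence_nonpos_of_isLocalMax
      (Filter.eventually_of_mem hnhds hw) (hV.differentiableAt hnhds)
      (hzmax.isLocalMax (Filter.mem_of_superset hnhds subset_closure))
    rw [hdiv z hzΩ] at hle
    exact le_max_of_le_left (nonpos_of_mul_nonpos_right hle hc)
  · have hbdd : BddAbove (w '' frontier Ω) :=
      (hcomp.bddAbove_image hwc).mono (image_mono frontier_subset_closure)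
    refine le_max_of_le_right (le_csSup hbdd (mem_image_of_mem w ?_))
    rw [hΩ.frontier_eq]
    exact ⟨hz, hzΩ⟩

/-- The divergence of a linear combination of two vector fields. -/
theorem vectorDivergence_smul_sub_smul {n : ℕ}
    {F G : EuclideanSpace ℝ (Fin n) → EuclideanSpace ℝ (Fin n)} {x : EuclideanSpace ℝ (Fin n)}
    (hF : DifferentiableAt ℝ F x) (hG : DifferentiableAt ℝ G x) (a b : ℝ) :
    vectorDivergence (fun y => a • F y - b • G y) x =
      a * vectorDivergence F x - b * vectorDivergence G x := by
  have h := ((hF.hasFDerivAt.const_smul a).sub (hG.hasFDerivAt.const_smul b)).fderiv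
  change fderiv ℝ (fun y => a • F y - b • G y) x = _ at h
  simp [vectorDivergence, h, Finset.mul_sum, Finset.sum_sub_distrib]

/-- Maximum principle for the double porosity/permeability model with
isotropic homogeneous permeabilities on a non-empty bounded open set `Ω ⊆ ℝⁿ`: the
pressure difference `p₁ - p₂` lies, everywhere in the closure of `Ω`, between the
non-positive minimum and the non-negative maximum of its boundary values. -/
theorem maximum_principle_double_porosity {n : ℕ}
    (Ω : Set (EuclideanSpace ℝ (Fin n))) (hΩ : IsOpen Ω)
    (hne : Ω.Nonempty) (hbd : Bornology.IsBounded Ω)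
    (μ β k₁ k₂ γ : ℝ) (hμ : 0 < μ) (hβ : 0 < β) (hk₁ : 0 < k₁) (hk₂ : 0 < k₂)
    (b u₁ u₂ : EuclideanSpace ℝ (Fin n) → EuclideanSpace ℝ (Fin n))
    (p₁ p₂ : EuclideanSpace ℝ (Fin n) → ℝ)
    (hb : DifferentiableOn ℝ b Ω)
    (hp₁c : ContinuousOn p₁ (closure Ω)) (hp₂c : ContinuousOn p₂ (closure Ω))
    (hp₁ : ContDiffOn ℝ 2 p₁ Ω) (hp₂ : ContDiffOn ℝ 2 p₂ Ω)
    (hu₁ : DifferentiableOn ℝ u₁ Ω) (hu₂ : DifferentiableOn ℝ u₂ Ω)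
    (heq₁ : ∀ x ∈ Ω, (μ / k₁) • u₁ x + gradient p₁ x = γ • b x)
    (heq₂ : ∀ x ∈ Ω, (μ / k₂) • u₂ x + gradient p₂ x = γ • b x)
    (heq₃ : ∀ x ∈ Ω, vectorDivergence u₁ x = -(β / μ) * (p₁ x - p₂ x))
    (heq₄ : ∀ x ∈ Ω, vectorDivergence u₂ x = (β / μ) * (p₁ x - p₂ x)) :
    ∀ x ∈ closure Ω,
      min 0 (sInf ((fun y => p₁ y - p₂ y) '' frontier Ω)) ≤ p₁ x - p₂ x ∧
      p₁ x - p₂ x ≤ max 0 (sSup ((fun y => p₁ y - p₂ y) '' frontier Ω)) := by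
  set w : EuclideanSpace ℝ (Fin n) → ℝ := fun y => p₁ y - p₂ y with hw_def
  have hwc : ContinuousOn w (closure Ω) := hp₁c.sub hp₂c
  have hc : 0 < β / k₁ + β / k₂ := by positivity
  have hgrad : ∀ x ∈ Ω, HasGradientAt w ((μ / k₂) • u₂ x - (μ / k₁) • u₁ x) x := by
    intro x hx
    have hnhds := hΩ.mem_nhds hx
    have h₁ := ((hp₁.contDiffAt hnhds).differentiableAt two_ne_zero).hasGradientAt
    have h₂ := ((hp₂.contDiffAt hnhds).differentiableAt two_ne_zero).hasGradientAt
    have heq : (μ / k₂) • u₂ x - (μ / k₁) • u₁ x = gradient p₁ x - gradient p₂ x := by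
      rw [sub_eq_sub_iff_add_eq_add, heq₂ x hx, add_comm, heq₁ x hx]
    rw [heq, hasGradientAt_iff_hasFDerivAt, map_sub]
    exact h₁.hasFDerivAt.sub h₂.hasFDerivAt
  have hdiv : ∀ x ∈ Ω, ∀ s : ℝ,
      vectorDivergence (fun y => (s * (μ / k₂)) • u₂ y - (s * (μ / k₁)) • u₁ y) x =
        (β / k₁ + β / k₂) * (s * w x) := by
    intro x hx s
    have hnhds := hΩ.mem_nhds hx
    rw [vectorDivergence_smul_sub_smul (hu₂.differentiableAt hnhds) (hu₁.differentiableAt hnhds),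
      heq₃ x hx, heq₄ x hx]
    simp only [hw_def]
    field_simp
    ring
  have hdiff : ∀ s : ℝ, DifferentiableOn ℝ
      (fun y => (s * (μ / k₂)) • u₂ y - (s * (μ / k₁)) • u₁ y) Ω := fun s =>
    (hu₂.fun_const_smul _).fun_sub (hu₁.fun_const_smul _)
  have hgrad_smul : ∀ s : ℝ, ∀ x ∈ Ω, HasGradientAt (fun y => s * w y)
      ((s * (μ / k₂)) • u₂ x - (s * (μ / k₁)) • u₁ x) x := by
    intro s x hx
    rw [mul_smul, mul_smul, ← smul_sub, hasGradientAt_iff_hasFDerivAt, map_smul]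
    exact (hgrad x hx).hasFDerivAt.const_mul s
  have hmax (s : ℝ) {x : EuclideanSpace ℝ (Fin n)} (hx : x ∈ closure Ω) :
      s * w x ≤ max 0 (sSup ((fun y => s * w y) '' frontier Ω)) :=
    le_max_zero_sSup_frontier_of_vectorDivergence_eq hΩ hbd hc (hwc.const_smul s)
      (hgrad_smul s) (hdiff s) (fun x hx => hdiv x hx s) hx
  intro x hx
  constructor
  · have h := hmax (-1) hx
    have himage : (fun y => -1 * w y) '' frontier Ω = -(w '' frontier Ω) := by
      rw [← image_neg_eq_neg, image_image]
      simp
    rw [himage] at h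
    rw [Real.sInf_def, ← neg_zero, min_neg_neg]
    linarith
  · simpa only [one_mul] using hmax 1 hx
end

section
/- Recovery of Darcy equations when the networks have equal permeabilities and equal boundary data: suppose that (u₁, u₂, p₁, p₂), with each function continuous on [0,1] and differentiable on (0,1), satisfies the non-dimensional one-dimensional double porosity/permeability system on (0,1) with k₁ = k₂, and that p₁(0) = p₂(0) and p₁(1) = p₂(1). Then p₁(x) = p₂(x) and u₁(x) = u₂(x) for all x ∈ [0,1]; in particular, the mass transfer p₂ - p₁ between the two pore-networks vanishes identically. -/
open Set

/-- A solution of `q' = -a v`, `v' = -b q` with `a, b > 0` and `q` vanishing at both ends of an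
interval is zero: the product `q v` is antitone and vanishes at both ends. -/
theorem eqOn_zero_of_hasDerivAt_neg_mul {a b s t : ℝ} {q v : ℝ → ℝ} (ha : 0 < a) (hb : 0 < b)
    (hst : s < t) (hqc : ContinuousOn q (Icc s t)) (hvc : ContinuousOn v (Icc s t))
    (hq : ∀ x ∈ Ioo s t, HasDerivAt q (-(a * v x)) x)
    (hv : ∀ x ∈ Ioo s t, HasDerivAt v (-(b * q x)) x)
    (hqs : q s = 0) (hqt : q t = 0) :
    EqOn q 0 (Icc s t) ∧ EqOn v 0 (Icc s t) := by
  have hd : ∀ x ∈ Ioo s t,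
      HasDerivAt (fun y => q y * v y) (-(a * v x) * v x + q x * -(b * q x)) x :=
    fun x hx => (hq x hx).mul (hv x hx)
  have hanti : AntitoneOn (fun y => q y * v y) (Icc s t) := by
    refine antitoneOn_of_deriv_nonpos (convex_Icc s t) (hqc.mul hvc) ?_ ?_ <;>
      rw [interior_Icc] <;> intro x hx
    · exact (hd x hx).differentiableAt.differentiableWithinAt
    · rw [(hd x hx).deriv]
      nlinarith [mul_nonneg ha.le (sq_nonneg (v x)), mul_nonneg hb.le (sq_nonneg (q x))]
  have hprod : ∀ x ∈ Icc s t, q x * v x = 0 := by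
    intro x hx
    have h₁ := hanti (left_mem_Icc.2 hst.le) hx hx.1
    have h₂ := hanti hx (right_mem_Icc.2 hst.le) hx.2
    simp only [hqs, hqt, zero_mul] at h₁ h₂
    exact le_antisymm h₁ h₂
  have hzero : ∀ x ∈ Ioo s t, q x = 0 ∧ v x = 0 := by
    intro x hx
    have hloc : (fun y => q y * v y) =ᶠ[nhds x] fun _ => 0 := by
      filter_upwards [Icc_mem_nhds hx.1 hx.2] with y hy using hprod y hy
    have h := (hd x hx).unique ((hasDerivAt_const x (0 : ℝ)).congr_of_eventuallyEq hloc)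
    have h₁ := mul_nonneg ha.le (sq_nonneg (v x))
    have h₂ := mul_nonneg hb.le (sq_nonneg (q x))
    have h₃ : a * v x ^ 2 = 0 := by linarith
    have h₄ : b * q x ^ 2 = 0 := by linarith
    simpa [ha.ne', hb.ne'] using And.intro h₄ h₃
  have hcl : Icc s t ⊆ closure (Ioo s t) := (closure_Ioo hst.ne).ge
  exact ⟨EqOn.of_subset_closure (fun x hx => (hzero x hx).1) hqc continuousOn_const
      Ioo_subset_Icc_self hcl,
    EqOn.of_subset_closure (fun x hx => (hzero x hx).2) hvc continuousOn_const
      Ioo_subset_Icc_self hcl⟩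

/-- Recovery of Darcy equations when the two pore-networks have equal
permeabilities and equal pressure boundary data: then `p₁ = p₂` and `u₁ = u₂` on `[0,1]`
(so the mass transfer `p₂ - p₁` vanishes identically). -/
theorem recovery_of_darcy_equal_permeabilities
    (μ k₁ k₂ : ℝ) (hμ : 0 < μ) (hk₁ : 0 < k₁) (hk₂ : 0 < k₂) (hk : k₁ = k₂)
    (u₁ u₂ p₁ p₂ : ℝ → ℝ)
    (hcont : ∀ f ∈ [u₁, u₂, p₁, p₂], ContinuousOn f (Icc 0 1))
    (hdiff : ∀ f ∈ [u₁, u₂, p₁, p₂], ∀ x ∈ Ioo (0:ℝ) 1, DifferentiableAt ℝ f x)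
    (heq₁ : ∀ x ∈ Ioo (0:ℝ) 1, μ / k₁ * u₁ x + deriv p₁ x = 0)
    (heq₂ : ∀ x ∈ Ioo (0:ℝ) 1, deriv u₁ x = -(p₁ x - p₂ x))
    (heq₃ : ∀ x ∈ Ioo (0:ℝ) 1, μ / k₂ * u₂ x + deriv p₂ x = 0)
    (heq₄ : ∀ x ∈ Ioo (0:ℝ) 1, deriv u₂ x = p₁ x - p₂ x)
    (hbc₀ : p₁ 0 = p₂ 0) (hbc₁ : p₁ 1 = p₂ 1) :
    ∀ x ∈ Icc (0:ℝ) 1, p₁ x = p₂ x ∧ u₁ x = u₂ x := by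
  subst hk
  simp only [List.forall_mem_cons, List.not_mem_nil, false_imp_iff, implies_true, and_true]
    at hcont hdiff
  obtain ⟨cu₁, cu₂, cp₁, cp₂⟩ := hcont
  obtain ⟨du₁, du₂, dp₁, dp₂⟩ := hdiff
  obtain ⟨hp, hu⟩ := eqOn_zero_of_hasDerivAt_neg_mul (q := fun x => p₁ x - p₂ x)
    (v := fun x => u₁ x - u₂ x) (div_pos hμ hk₁) two_pos zero_lt_one
    (cp₁.sub cp₂) (cu₁.sub cu₂)
    (fun x hx => ((dp₁ x hx).hasDerivAt.sub (dp₂ x hx).hasDerivAt).congr_deriv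
      (by linear_combination heq₁ x hx - heq₃ x hx))
    (fun x hx => ((du₁ x hx).hasDerivAt.sub (du₂ x hx).hasDerivAt).congr_deriv
      (by linear_combination heq₂ x hx - heq₄ x hx))
    (sub_eq_zero.2 hbc₀) (sub_eq_zero.2 hbc₁)
  exact fun x hx => ⟨sub_eq_zero.1 (hp hx), sub_eq_zero.1 (hu hx)⟩
end

section
/- Minimum dissipation theorem (one-dimensional version): let (u₁, u₂, p₁, p₂) satisfy the heterogeneous one-dimensional double porosity/permeability system with body force on [0,1], with u₁, u₂, p₁, p₂ continuously differentiable on [0,1]. Define the dissipation functional Φ[w₁, w₂] := ∫₀¹ [ (μ/k₁(x))·w₁(x)² + (μ/k₂(x))·w₂(x)² + (μ/(2β))·(w₁'(x))² + (μ/(2β))·(w₂'(x))² ] dx. Then for every kinematically admissible pair (w₁, w₂) — that is, every pair of continuously differentiable functions w₁, w₂ : [0,1] → ℝ with w₁'(x) + w₂'(x) = 0 for all x ∈ (0,1), w₁(0) = u₁(0), w₁(1) = u₁(1), w₂(0) = u₂(0), and w₂(1) = u₂(1) — one has Φ[u₁, u₂] ≤ Φ[w₁, w₂]. -/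
open Set

/-- A function that is `C¹` on `[a, b]` is differentiable on the interior, with `deriv` being
the restriction of a continuous function on `[a, b]`. -/
theorem ContDiffOn.exists_continuousOn_hasDerivAt {f : ℝ → ℝ} {a b : ℝ} (hab : a < b)
    (hf : ContDiffOn ℝ 1 f (Icc a b)) :
    ∃ g : ℝ → ℝ, ContinuousOn g (Icc a b) ∧ (∀ x ∈ Ioo a b, HasDerivAt f (g x) x) ∧
      ∀ x ∈ Ioo a b, deriv f x = g x := by
  have key : ∀ x ∈ Ioo a b, HasDerivAt f (derivWithin f (Icc a b) x) x := fun x hx =>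
    (hf.differentiableOn one_ne_zero x (Ioo_subset_Icc_self hx)).hasDerivWithinAt.hasDerivAt
      (Icc_mem_nhds hx.1 hx.2)
  exact ⟨derivWithin f (Icc a b), hf.continuousOn_derivWithin (uniqueDiffOn_Icc hab) le_rfl, key,
    fun x hx => (key x hx).deriv⟩

/-- A continuous function on `[a, b]` whose derivative vanishes on `(a, b)` is constant. -/
theorem eq_left_of_hasDerivAt_zero {f : ℝ → ℝ} {a b : ℝ} (hf : ContinuousOn f (Icc a b))
    (hf' : ∀ x ∈ Ioo a b, HasDerivAt f 0 x) {x : ℝ} (hx : x ∈ Icc a b) : f x = f a := by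
  have h := intervalIntegral.integral_eq_sub_of_hasDerivAt_of_le (f' := fun _ => (0 : ℝ)) hx.1
    (hf.mono (Icc_subset_Icc_right hx.2)) (fun y hy => hf' y ⟨hy.1, hy.2.trans_le hx.2⟩)
    intervalIntegrable_const
  rw [intervalIntegral.integral_zero] at h
  linarith

/-- The dissipation density of an admissible perturbation dominates the original density up to
the exact derivative of (pressure difference) × (velocity perturbation). -/
theorem dissipation_density_le {μ β c₁ c₂ u₁ u₂ w₁ w₂ du₁ du₂ dw₁ dw₂ p₁ p₂ dp₁ dp₂ f : ℝ}
    (hμ : 0 < μ) (hβ : 0 < β) (hc₁ : 0 ≤ c₁) (hc₂ : 0 ≤ c₂)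
    (h₁ : c₁ * u₁ + dp₁ = f) (h₂ : c₂ * u₂ + dp₂ = f)
    (h₃ : du₁ = -(β / μ) * (p₁ - p₂)) (h₄ : du₂ = (β / μ) * (p₁ - p₂))
    (hdw : dw₁ + dw₂ = 0) (hw : w₁ + w₂ = u₁ + u₂) :
    c₁ * u₁ ^ 2 + c₂ * u₂ ^ 2 + μ / (2 * β) * du₁ ^ 2 + μ / (2 * β) * du₂ ^ 2
        - 2 * ((dp₁ - dp₂) * (w₁ - u₁) + (p₁ - p₂) * (dw₁ - du₁))
      ≤ c₁ * w₁ ^ 2 + c₂ * w₂ ^ 2 + μ / (2 * β) * dw₁ ^ 2 + μ / (2 * β) * dw₂ ^ 2 := by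
  have hp : p₁ - p₂ = -(μ / β) * du₁ := by rw [h₃]; field_simp
  have hdp : dp₁ - dp₂ = c₂ * u₂ - c₁ * u₁ := by linarith
  obtain rfl : du₂ = -du₁ := by rw [h₃, h₄]; ring
  obtain rfl : dw₂ = -dw₁ := by linarith
  obtain rfl : w₂ = u₁ + u₂ - w₁ := by linarith
  have hsq : 0 ≤ (c₁ + c₂) * (w₁ - u₁) ^ 2 + μ / β * (dw₁ - du₁) ^ 2 := by positivity
  have hhalf : μ / (2 * β) = μ / β / 2 := by field_simp
  rw [hp, hdp, hhalf]
  linarith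

/-- Minimum dissipation theorem (one-dimensional version): the true velocity
pair `(u₁, u₂)` of the heterogeneous one-dimensional double porosity/permeability system
with body force minimizes the dissipation functional
`Φ[w₁,w₂] = ∫₀¹ (μ/k₁)w₁² + (μ/k₂)w₂² + (μ/2β)(w₁')² + (μ/2β)(w₂')²`
over all kinematically admissible pairs `(w₁, w₂)`. -/
theorem minimum_dissipation_one_dimensional
    (μ β γ : ℝ) (hμ : 0 < μ) (hβ : 0 < β)
    (k₁ k₂ b : ℝ → ℝ)
    (hk₁c : ContinuousOn k₁ (Icc 0 1)) (hk₂c : ContinuousOn k₂ (Icc 0 1))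
    (hk₁ : ∀ x ∈ Icc (0:ℝ) 1, 0 < k₁ x) (hk₂ : ∀ x ∈ Icc (0:ℝ) 1, 0 < k₂ x)
    (hb : ContinuousOn b (Icc 0 1))
    (u₁ u₂ p₁ p₂ : ℝ → ℝ)
    (hreg : ∀ f ∈ [u₁, u₂, p₁, p₂], ContDiffOn ℝ 1 f (Icc 0 1))
    (heq₁ : ∀ x ∈ Ioo (0:ℝ) 1, μ / k₁ x * u₁ x + deriv p₁ x = γ * b x)
    (heq₂ : ∀ x ∈ Ioo (0:ℝ) 1, μ / k₂ x * u₂ x + deriv p₂ x = γ * b x)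
    (heq₃ : ∀ x ∈ Ioo (0:ℝ) 1, deriv u₁ x = -(β / μ) * (p₁ x - p₂ x))
    (heq₄ : ∀ x ∈ Ioo (0:ℝ) 1, deriv u₂ x = (β / μ) * (p₁ x - p₂ x)) :
    ∀ w₁ w₂ : ℝ → ℝ,
      ContDiffOn ℝ 1 w₁ (Icc 0 1) → ContDiffOn ℝ 1 w₂ (Icc 0 1) →
      (∀ x ∈ Ioo (0:ℝ) 1, deriv w₁ x + deriv w₂ x = 0) →
      w₁ 0 = u₁ 0 → w₁ 1 = u₁ 1 → w₂ 0 = u₂ 0 → w₂ 1 = u₂ 1 →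
      (∫ x in (0:ℝ)..1,
          (μ / k₁ x * (u₁ x) ^ 2 + μ / k₂ x * (u₂ x) ^ 2
            + μ / (2 * β) * (deriv u₁ x) ^ 2 + μ / (2 * β) * (deriv u₂ x) ^ 2))
        ≤ ∫ x in (0:ℝ)..1,
          (μ / k₁ x * (w₁ x) ^ 2 + μ / k₂ x * (w₂ x) ^ 2
            + μ / (2 * β) * (deriv w₁ x) ^ 2 + μ / (2 * β) * (deriv w₂ x) ^ 2) := by
  intro w₁ w₂ hw₁ hw₂ hdiv hw₁0 hw₁1 hw₂0 hw₂1
  have hu₁ : ContDiffOn ℝ 1 u₁ (Icc 0 1) := hreg _ (by simp)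
  have hu₂ : ContDiffOn ℝ 1 u₂ (Icc 0 1) := hreg _ (by simp)
  have hp₁ : ContDiffOn ℝ 1 p₁ (Icc 0 1) := hreg _ (by simp)
  have hp₂ : ContDiffOn ℝ 1 p₂ (Icc 0 1) := hreg _ (by simp)
  obtain ⟨du₁, cdu₁, hdu₁, edu₁⟩ := hu₁.exists_continuousOn_hasDerivAt one_pos
  obtain ⟨du₂, cdu₂, hdu₂, edu₂⟩ := hu₂.exists_continuousOn_hasDerivAt one_pos
  obtain ⟨dp₁, cdp₁, hdp₁, edp₁⟩ := hp₁.exists_continuousOn_hasDerivAt one_pos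
  obtain ⟨dp₂, cdp₂, hdp₂, edp₂⟩ := hp₂.exists_continuousOn_hasDerivAt one_pos
  obtain ⟨dw₁, cdw₁, hdw₁, edw₁⟩ := hw₁.exists_continuousOn_hasDerivAt one_pos
  obtain ⟨dw₂, cdw₂, hdw₂, edw₂⟩ := hw₂.exists_continuousOn_hasDerivAt one_pos
  have cu₁ := hu₁.continuousOn
  have cu₂ := hu₂.continuousOn
  have cp₁ := hp₁.continuousOn
  have cp₂ := hp₂.continuousOn
  have cw₁ := hw₁.continuousOn
  have cw₂ := hw₂.continuousOn
  have cc₁ : ContinuousOn (fun x => μ / k₁ x) (Icc 0 1) :=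
    continuousOn_const.div hk₁c fun x hx => (hk₁ x hx).ne'
  have cc₂ : ContinuousOn (fun x => μ / k₂ x) (Icc 0 1) :=
    continuousOn_const.div hk₂c fun x hx => (hk₂ x hx).ne'
  have hsum : ∀ x ∈ Icc (0 : ℝ) 1, w₁ x + w₂ x = u₁ x + u₂ x := by
    intro x hx
    have h := eq_left_of_hasDerivAt_zero
      (f := fun x => w₁ x + w₂ x - (u₁ x + u₂ x)) (by fun_prop) (fun y hy => by
        have hz : dw₁ y + dw₂ y - (du₁ y + du₂ y) = 0 := by
          rw [← edw₁ y hy, ← edw₂ y hy, ← edu₁ y hy, ← edu₂ y hy, hdiv y hy, heq₃ y hy,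
            heq₄ y hy]
          ring
        exact hz ▸ ((hdw₁ y hy).add (hdw₂ y hy)).sub ((hdu₁ y hy).add (hdu₂ y hy))) hx
    simp only [hw₁0, hw₂0] at h
    linarith
  have hΦ : ∀ v₁ v₂ dv₁ dv₂ : ℝ → ℝ, ContinuousOn v₁ (Icc 0 1) → ContinuousOn v₂ (Icc 0 1) →
      ContinuousOn dv₁ (Icc 0 1) → ContinuousOn dv₂ (Icc 0 1) →
      IntervalIntegrable (fun x => μ / k₁ x * (v₁ x) ^ 2 + μ / k₂ x * (v₂ x) ^ 2
        + μ / (2 * β) * (dv₁ x) ^ 2 + μ / (2 * β) * (dv₂ x) ^ 2) MeasureTheory.volume 0 1 :=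
    fun v₁ v₂ dv₁ dv₂ _ _ _ _ =>
      ContinuousOn.intervalIntegrable_of_Icc zero_le_one (by fun_prop)
  have hIu := hΦ u₁ u₂ du₁ du₂ cu₁ cu₂ cdu₁ cdu₂
  have hIw := hΦ w₁ w₂ dw₁ dw₂ cw₁ cw₂ cdw₁ cdw₂
  have hIG : IntervalIntegrable (fun x => (dp₁ x - dp₂ x) * (w₁ x - u₁ x)
      + (p₁ x - p₂ x) * (dw₁ x - du₁ x)) MeasureTheory.volume 0 1 :=
    ContinuousOn.intervalIntegrable_of_Icc zero_le_one (by fun_prop)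
  have hG : ∫ x in (0 : ℝ)..1, ((dp₁ x - dp₂ x) * (w₁ x - u₁ x)
      + (p₁ x - p₂ x) * (dw₁ x - du₁ x)) = 0 := by
    refine (intervalIntegral.integral_eq_sub_of_hasDerivAt_of_le
      (f := fun x => (p₁ x - p₂ x) * (w₁ x - u₁ x)) zero_le_one (by fun_prop)
      (fun x hx => ((hdp₁ x hx).sub (hdp₂ x hx)).mul ((hdw₁ x hx).sub (hdu₁ x hx))) hIG).trans ?_
    simp [hw₁0, hw₁1]
  have hmono := intervalIntegral.integral_mono_on_of_le_Ioo zero_le_one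
    (hIu.sub (hIG.const_mul 2)) hIw fun x hx => by
      have hx' := Ioo_subset_Icc_self hx
      exact dissipation_density_le hμ hβ (div_pos hμ (hk₁ x hx')).le (div_pos hμ (hk₂ x hx')).le
        (edp₁ x hx ▸ heq₁ x hx) (edp₂ x hx ▸ heq₂ x hx) (edu₁ x hx ▸ heq₃ x hx)
        (edu₂ x hx ▸ heq₄ x hx) (edw₁ x hx ▸ edw₂ x hx ▸ hdiv x hx) (hsum x hx')
  rw [intervalIntegral.integral_sub hIu (hIG.const_mul 2), intervalIntegral.integral_const_mul,
    hG, mul_zero, sub_zero] at hmono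
  convert hmono using 1 <;>
    refine intervalIntegral.integral_congr_Ioo_of_le zero_le_one fun x hx => ?_
  · simp only [edu₁ x hx, edu₂ x hx]
  · simp only [edw₁ x hx, edw₂ x hx]
end

section
/- Reciprocal relation (one-dimensional version, pressure data prescribed at both endpoints for both networks): let (u₁ᵃ, u₂ᵃ, p₁ᵃ, p₂ᵃ) and (u₁ᵇ, u₂ᵇ, p₁ᵇ, p₂ᵇ) be two quadruples of continuously differentiable functions on [0,1] satisfying the heterogeneous one-dimensional double porosity/permeability system with body force on [0,1], with respective body forces bᵃ and bᵇ (and the same μ, β, γ, k₁, k₂). Then: ∫₀¹ γ·bᵃ(x)·u₁ᵇ(x) dx - [p₁ᵃ(1)·u₁ᵇ(1) - p₁ᵃ(0)·u₁ᵇ(0)] + ∫₀¹ γ·bᵃ(x)·u₂ᵇ(x) dx - [p₂ᵃ(1)·u₂ᵇ(1) - p₂ᵃ(0)·u₂ᵇ(0)] = ∫₀¹ γ·bᵇ(x)·u₁ᵃ(x) dx - [p₁ᵇ(1)·u₁ᵃ(1) - p₁ᵇ(0)·u₁ᵃ(0)] + ∫₀¹ γ·bᵇ(x)·u₂ᵃ(x)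 dx - [p₂ᵇ(1)·u₂ᵃ(1) - p₂ᵇ(0)·u₂ᵃ(0)]. -/
open Set

/-- Reciprocal relation (one-dimensional version) for two solutions of the
heterogeneous one-dimensional double porosity/permeability system with respective body
forces `bᵃ` and `bᵇ`. -/
theorem reciprocal_relation_one_dimensional
    (μ β γ : ℝ) (hμ : 0 < μ) (hβ : 0 < β)
    (k₁ k₂ : ℝ → ℝ)
    (hk₁c : ContinuousOn k₁ (Icc 0 1)) (hk₂c : ContinuousOn k₂ (Icc 0 1))
    (hk₁ : ∀ x ∈ Icc (0:ℝ) 1, 0 < k₁ x) (hk₂ : ∀ x ∈ Icc (0:ℝ) 1, 0 < k₂ x)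
    (ba bb : ℝ → ℝ)
    (hba : ContinuousOn ba (Icc 0 1)) (hbb : ContinuousOn bb (Icc 0 1))
    (u₁a u₂a p₁a p₂a u₁b u₂b p₁b p₂b : ℝ → ℝ)
    (hreg : ∀ f ∈ [u₁a, u₂a, p₁a, p₂a, u₁b, u₂b, p₁b, p₂b], ContDiffOn ℝ 1 f (Icc 0 1))
    (heq₁a : ∀ x ∈ Ioo (0:ℝ) 1, μ / k₁ x * u₁a x + deriv p₁a x = γ * ba x)
    (heq₂a : ∀ x ∈ Ioo (0:ℝ) 1, μ / k₂ x * u₂a x + deriv p₂a x = γ * ba x)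
    (heq₃a : ∀ x ∈ Ioo (0:ℝ) 1, deriv u₁a x = -(β / μ) * (p₁a x - p₂a x))
    (heq₄a : ∀ x ∈ Ioo (0:ℝ) 1, deriv u₂a x = (β / μ) * (p₁a x - p₂a x))
    (heq₁b : ∀ x ∈ Ioo (0:ℝ) 1, μ / k₁ x * u₁b x + deriv p₁b x = γ * bb x)
    (heq₂b : ∀ x ∈ Ioo (0:ℝ) 1, μ / k₂ x * u₂b x + deriv p₂b x = γ * bb x)
    (heq₃b : ∀ x ∈ Ioo (0:ℝ) 1, deriv u₁b x = -(β / μ) * (p₁b x - p₂b x))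
    (heq₄b : ∀ x ∈ Ioo (0:ℝ) 1, deriv u₂b x = (β / μ) * (p₁b x - p₂b x)) :
    (∫ x in (0:ℝ)..1, γ * ba x * u₁b x) - (p₁a 1 * u₁b 1 - p₁a 0 * u₁b 0)
      + (∫ x in (0:ℝ)..1, γ * ba x * u₂b x) - (p₂a 1 * u₂b 1 - p₂a 0 * u₂b 0)
    = (∫ x in (0:ℝ)..1, γ * bb x * u₁a x) - (p₁b 1 * u₁a 1 - p₁b 0 * u₁a 0)
      + (∫ x in (0:ℝ)..1, γ * bb x * u₂a x) - (p₂b 1 * u₂a 1 - p₂b 0 * u₂a 0) := by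
  simp only [List.mem_cons, List.not_mem_nil, or_false, forall_eq_or_imp, forall_eq] at hreg
  obtain ⟨hu₁a, hu₂a, hp₁a, hp₂a, hu₁b, hu₂b, hp₁b, hp₂b⟩ := hreg
  have hder {f : ℝ → ℝ} (hf : ContDiffOn ℝ 1 f (Icc 0 1)) {x : ℝ} (hx : x ∈ Ioo (0:ℝ) 1) :
      HasDerivAt f (deriv f x) x :=
    ((hf.differentiableOn one_ne_zero).differentiableAt (Icc_mem_nhds hx.1 hx.2)).hasDerivAt
  have hint {c u : ℝ → ℝ} (hc : ContinuousOn c (Icc 0 1)) (hu : ContDiffOn ℝ 1 u (Icc 0 1)) :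
      IntervalIntegrable (fun x => γ * c x * u x) MeasureTheory.volume 0 1 :=
    ((continuousOn_const.mul hc).mul hu.continuousOn).intervalIntegrable_of_Icc zero_le_one
  have hI₁b := hint hba hu₁b
  have hI₂b := hint hba hu₂b
  have hI₁a := hint hbb hu₁a
  have hI₂a := hint hbb hu₂a
  have hFTC := intervalIntegral.integral_eq_sub_of_hasDerivAt_of_le zero_le_one
    (f := fun x => p₁a x * u₁b x + p₂a x * u₂b x - (p₁b x * u₁a x + p₂b x * u₂a x))
    (f' := fun x => γ * ba x * u₁b x + γ * ba x * u₂b x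
      - (γ * bb x * u₁a x + γ * bb x * u₂a x))
    (((hp₁a.continuousOn.mul hu₁b.continuousOn).add
      (hp₂a.continuousOn.mul hu₂b.continuousOn)).sub
      ((hp₁b.continuousOn.mul hu₁a.continuousOn).add
        (hp₂b.continuousOn.mul hu₂a.continuousOn)))
    (fun x hx => by
      refine ((((hder hp₁a hx).mul (hder hu₁b hx)).add
        ((hder hp₂a hx).mul (hder hu₂b hx))).sub
        (((hder hp₁b hx).mul (hder hu₁a hx)).add
          ((hder hp₂b hx).mul (hder hu₂a hx)))).congr_deriv ?_
      rw [heq₃a x hx, heq₄a x hx, heq₃b x hx, heq₄b x hx]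
      linear_combination u₁b x * heq₁a x hx + u₂b x * heq₂a x hx
        - u₁a x * heq₁b x hx - u₂a x * heq₂b x hx)
    ((hI₁b.add hI₂b).sub (hI₁a.add hI₂a))
  rw [intervalIntegral.integral_sub (hI₁b.add hI₂b) (hI₁a.add hI₂a),
    intervalIntegral.integral_add hI₁b hI₂b, intervalIntegral.integral_add hI₁a hI₂a] at hFTC
  linear_combination hFTC
end

section
/- Symmetric-form identity underlying the reciprocal relation (one-dimensional version): let (u₁ᵃ, u₂ᵃ, p₁ᵃ, p₂ᵃ) and (u₁ᵇ, u₂ᵇ, p₁ᵇ, p₂ᵇ) be two quadruples of continuously differentiable functions on [0,1] satisfying the heterogeneous one-dimensional double porosity/permeability system with body force on [0,1], with respective body forces bᵃ and bᵇ (and the same μ, β, γ, k₁, k₂). Then: ∫₀¹ γ·bᵃ(x)·u₁ᵇ(x) dx - [p₁ᵃ(1)·u₁ᵇ(1) - p₁ᵃ(0)·u₁ᵇ(0)] + ∫₀¹ γ·bᵃ(x)·u₂ᵇ(x) dx - [p₂ᵃ(1)·u₂ᵇ(1) - p₂ᵃ(0)·u₂ᵇ(0)] = ∫₀¹ [ (μ/k₁(x))·u₁ᵃ(x)·u₁ᵇ(x)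 + (μ/k₂(x))·u₂ᵃ(x)·u₂ᵇ(x) + (β/μ)·(p₁ᵃ(x) - p₂ᵃ(x))·(p₁ᵇ(x) - p₂ᵇ(x)) ] dx; in particular, the left-hand side is symmetric under interchange of the labels a and b. -/
open Set

/-- Testing the momentum balances of state `a` against the velocities of state `b` and
integrating by parts yields the symmetric bilinear dissipation integral. -/
theorem body_force_work_sub_boundary_eq_dissipation
    {μ β γ : ℝ} {k₁ k₂ f u₁a u₂a p₁a p₂a u₁b u₂b p₁b p₂b : ℝ → ℝ}
    (hk₁c : ContinuousOn k₁ (Icc 0 1)) (hk₂c : ContinuousOn k₂ (Icc 0 1))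
    (hk₁ : ∀ x ∈ Icc (0:ℝ) 1, k₁ x ≠ 0) (hk₂ : ∀ x ∈ Icc (0:ℝ) 1, k₂ x ≠ 0)
    (hf : ContinuousOn f (Icc 0 1))
    (hu₁a : ContinuousOn u₁a (Icc 0 1)) (hu₂a : ContinuousOn u₂a (Icc 0 1))
    (hp₁b : ContinuousOn p₁b (Icc 0 1)) (hp₂b : ContinuousOn p₂b (Icc 0 1))
    (hp₁a : ContDiffOn ℝ 1 p₁a (Icc 0 1)) (hp₂a : ContDiffOn ℝ 1 p₂a (Icc 0 1))
    (hu₁b : ContDiffOn ℝ 1 u₁b (Icc 0 1)) (hu₂b : ContDiffOn ℝ 1 u₂b (Icc 0 1))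
    (heq₁ : ∀ x ∈ Ioo (0:ℝ) 1, μ / k₁ x * u₁a x + deriv p₁a x = γ * f x)
    (heq₂ : ∀ x ∈ Ioo (0:ℝ) 1, μ / k₂ x * u₂a x + deriv p₂a x = γ * f x)
    (heq₃ : ∀ x ∈ Ioo (0:ℝ) 1, deriv u₁b x = -(β / μ) * (p₁b x - p₂b x))
    (heq₄ : ∀ x ∈ Ioo (0:ℝ) 1, deriv u₂b x = (β / μ) * (p₁b x - p₂b x)) :
    (∫ x in (0:ℝ)..1, γ * f x * u₁b x) - (p₁a 1 * u₁b 1 - p₁a 0 * u₁b 0)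
        + (∫ x in (0:ℝ)..1, γ * f x * u₂b x) - (p₂a 1 * u₂b 1 - p₂a 0 * u₂b 0)
      = ∫ x in (0:ℝ)..1,
          (μ / k₁ x * u₁a x * u₁b x + μ / k₂ x * u₂a x * u₂b x
            + β / μ * (p₁a x - p₂a x) * (p₁b x - p₂b x)) := by
  have hasDeriv {g : ℝ → ℝ} (hg : ContDiffOn ℝ 1 g (Icc 0 1)) {x : ℝ}
      (hx : x ∈ Ioo (0:ℝ) 1) : HasDerivAt g (deriv g x) x :=
    ((hg.differentiableOn one_ne_zero).differentiableAt
      (Icc_mem_nhds hx.1 hx.2)).hasDerivAt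
  have intble {g : ℝ → ℝ} (hg : ContinuousOn g (Icc 0 1)) :
      IntervalIntegrable g MeasureTheory.volume 0 1 :=
    hg.intervalIntegrable_of_Icc zero_le_one
  have cp₁a := hp₁a.continuousOn
  have cp₂a := hp₂a.continuousOn
  have cu₁b := hu₁b.continuousOn
  have cu₂b := hu₂b.continuousOn
  have i₁ : IntervalIntegrable (fun x => γ * f x * u₁b x) MeasureTheory.volume 0 1 :=
    intble (by fun_prop)
  have i₂ : IntervalIntegrable (fun x => γ * f x * u₂b x) MeasureTheory.volume 0 1 :=
    intble (by fun_prop)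
  have i₃ : IntervalIntegrable (fun x => μ / k₁ x * u₁a x * u₁b x + μ / k₂ x * u₂a x * u₂b x
      + β / μ * (p₁a x - p₂a x) * (p₁b x - p₂b x)) MeasureTheory.volume 0 1 := by
    have c₁ : ContinuousOn (fun x => μ / k₁ x) (Icc 0 1) := continuousOn_const.div hk₁c hk₁
    have c₂ : ContinuousOn (fun x => μ / k₂ x) (Icc 0 1) := continuousOn_const.div hk₂c hk₂
    exact intble (by fun_prop)
  have key := intervalIntegral.integral_eq_sub_of_hasDerivAt_of_le (zero_le_one' ℝ)
    (f := fun x => p₁a x * u₁b x + p₂a x * u₂b x) (by fun_prop)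
    (fun x hx => by
      refine (((hasDeriv hp₁a hx).mul (hasDeriv hu₁b hx)).add
        ((hasDeriv hp₂a hx).mul (hasDeriv hu₂b hx))).congr_deriv ?_
      rw [heq₃ x hx, heq₄ x hx]
      linear_combination u₁b x * heq₁ x hx + u₂b x * heq₂ x hx)
    ((i₁.add i₂).sub i₃)
  have split := intervalIntegral.integral_sub (i₁.add i₂) i₃
  rw [intervalIntegral.integral_add i₁ i₂] at split
  linarith [key.symm.trans split]

/-- Symmetric-form identity underlying the reciprocal relation
(one-dimensional version): each side of the reciprocal relation equals the symmetric
bilinear dissipation integral; in particular the left-hand side is symmetric under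
interchange of the labels `a` and `b`. -/
theorem reciprocal_relation_symmetric_form
    (μ β γ : ℝ) (hμ : 0 < μ) (hβ : 0 < β)
    (k₁ k₂ : ℝ → ℝ)
    (hk₁c : ContinuousOn k₁ (Icc 0 1)) (hk₂c : ContinuousOn k₂ (Icc 0 1))
    (hk₁ : ∀ x ∈ Icc (0:ℝ) 1, 0 < k₁ x) (hk₂ : ∀ x ∈ Icc (0:ℝ) 1, 0 < k₂ x)
    (ba bb : ℝ → ℝ)
    (hba : ContinuousOn ba (Icc 0 1)) (hbb : ContinuousOn bb (Icc 0 1))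
    (u₁a u₂a p₁a p₂a u₁b u₂b p₁b p₂b : ℝ → ℝ)
    (hreg : ∀ f ∈ [u₁a, u₂a, p₁a, p₂a, u₁b, u₂b, p₁b, p₂b], ContDiffOn ℝ 1 f (Icc 0 1))
    (heq₁a : ∀ x ∈ Ioo (0:ℝ) 1, μ / k₁ x * u₁a x + deriv p₁a x = γ * ba x)
    (heq₂a : ∀ x ∈ Ioo (0:ℝ) 1, μ / k₂ x * u₂a x + deriv p₂a x = γ * ba x)
    (heq₃a : ∀ x ∈ Ioo (0:ℝ) 1, deriv u₁a x = -(β / μ) * (p₁a x - p₂a x))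
    (heq₄a : ∀ x ∈ Ioo (0:ℝ) 1, deriv u₂a x = (β / μ) * (p₁a x - p₂a x))
    (heq₁b : ∀ x ∈ Ioo (0:ℝ) 1, μ / k₁ x * u₁b x + deriv p₁b x = γ * bb x)
    (heq₂b : ∀ x ∈ Ioo (0:ℝ) 1, μ / k₂ x * u₂b x + deriv p₂b x = γ * bb x)
    (heq₃b : ∀ x ∈ Ioo (0:ℝ) 1, deriv u₁b x = -(β / μ) * (p₁b x - p₂b x))
    (heq₄b : ∀ x ∈ Ioo (0:ℝ) 1, deriv u₂b x = (β / μ) * (p₁b x - p₂b x)) :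
    ((∫ x in (0:ℝ)..1, γ * ba x * u₁b x) - (p₁a 1 * u₁b 1 - p₁a 0 * u₁b 0)
        + (∫ x in (0:ℝ)..1, γ * ba x * u₂b x) - (p₂a 1 * u₂b 1 - p₂a 0 * u₂b 0)
      = ∫ x in (0:ℝ)..1,
          (μ / k₁ x * u₁a x * u₁b x + μ / k₂ x * u₂a x * u₂b x
            + β / μ * (p₁a x - p₂a x) * (p₁b x - p₂b x))) ∧
    ((∫ x in (0:ℝ)..1, γ * ba x * u₁b x) - (p₁a 1 * u₁b 1 - p₁a 0 * u₁b 0)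
        + (∫ x in (0:ℝ)..1, γ * ba x * u₂b x) - (p₂a 1 * u₂b 1 - p₂a 0 * u₂b 0)
      = (∫ x in (0:ℝ)..1, γ * bb x * u₁a x) - (p₁b 1 * u₁a 1 - p₁b 0 * u₁a 0)
        + (∫ x in (0:ℝ)..1, γ * bb x * u₂a x) - (p₂b 1 * u₂a 1 - p₂b 0 * u₂a 0)) := by
  simp only [List.forall_mem_cons] at hreg
  obtain ⟨hu₁a, hu₂a, hp₁a, hp₂a, hu₁b, hu₂b, hp₁b, hp₂b, -⟩ := hreg
  have hk₁' : ∀ x ∈ Icc (0:ℝ) 1, k₁ x ≠ 0 := fun x hx => (hk₁ x hx).ne'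
  have hk₂' : ∀ x ∈ Icc (0:ℝ) 1, k₂ x ≠ 0 := fun x hx => (hk₂ x hx).ne'
  have hab := body_force_work_sub_boundary_eq_dissipation hk₁c hk₂c hk₁' hk₂' hba
    hu₁a.continuousOn hu₂a.continuousOn hp₁b.continuousOn hp₂b.continuousOn
    hp₁a hp₂a hu₁b hu₂b heq₁a heq₂a heq₃b heq₄b
  have hba' := body_force_work_sub_boundary_eq_dissipation hk₁c hk₂c hk₁' hk₂' hbb
    hu₁b.continuousOn hu₂b.continuousOn hp₁a.continuousOn hp₂a.continuousOn
    hp₁b hp₂b hu₁a hu₂a heq₁b heq₂b heq₃a heq₄a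
  refine ⟨hab, hab.trans (Eq.trans ?_ hba'.symm)⟩
  congr 1 with x
  ring
end

section
/- Analytical solution of the one-dimensional problem with no-flux micro-pore boundary conditions: fix μ, k₁, k₂ > 0, set η := √(μ(k₁+k₂)/(k₁k₂)), define D₁ := (k₁ + k₂)/( k₁·η·(e^{η} + 1) + 2·k₂·(e^{η} - 1) ), D₂ := -e^{η}·D₁, and S := 2 + coth(η/2)·(k₁η/k₂), where coth(z) := cosh(z)/sinh(z). Define, for x ∈ ℝ: p₁(x) := 1 - x - (1 - 2x)/S - (μ/(k₁η²))·(D₁e^{ηx} + D₂e^{-ηx}); p₂(x) := 1 - x - (1 - 2x)/S + (μ/(k₂η²))·(D₁e^{ηx} + D₂e^{-ηx}); u₁(x) := k₁/μ - (k₁/μ)·(2/S) + (1/η)·(D₁e^{ηx} - D₂e^{-ηx}); u₂(x) := k₂/μ - (k₂/μ)·(2/S) - (1/η)·(D₁e^{ηx} - D₂e^{-ηx}). Then (u₁, u₂, p₁, p₂) satisfies the non-dimensional one-dimensional double porosity/permeability system on (0,1), together with the boundary conditions p₁(0) = 1, p₁(1) = 0, u₂(0) = 0, and u₂(1) = 0.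 -/
open Set

theorem hasDerivAt_exp_combination (a b c x : ℝ) :
    HasDerivAt (fun y ↦ a * Real.exp (c * y) + b * Real.exp (-(c * y)))
      (c * (a * Real.exp (c * x) - b * Real.exp (-(c * x)))) x := by
  have h : HasDerivAt (fun y : ℝ ↦ c * y) c x := by
    simpa using (hasDerivAt_id x).const_mul c
  exact ((h.exp.const_mul a).add (h.fun_neg.exp.const_mul b)).congr_deriv (by ring)

theorem cosh_half_div_sinh_half (x : ℝ) :
    Real.cosh (x / 2) / Real.sinh (x / 2) = (Real.exp x + 1) / (Real.exp x - 1) := by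
  have hx : Real.exp x = Real.exp (x / 2) * Real.exp (x / 2) := by
    rw [← Real.exp_add, add_halves]
  rw [Real.cosh_eq, Real.sinh_eq, Real.exp_neg, hx,
    div_div_div_cancel_right₀ two_ne_zero,
    ← mul_div_mul_left _ _ (Real.exp_ne_zero (x / 2)), mul_add, mul_sub,
    mul_inv_cancel₀ (Real.exp_ne_zero _)]

/-- The explicit fields `(u₁, u₂, p₁, p₂)` built from the constants
`D₁, D₂, S` solve the non-dimensional one-dimensional double porosity/permeability
system on `(0,1)` with boundary conditions `p₁(0) = 1`, `p₁(1) = 0`, `u₂(0) = 0`,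
`u₂(1) = 0` (no-flux micro-pore boundary conditions). -/
theorem analytical_solution_problem_two
    (μ k₁ k₂ η : ℝ) (hμ : 0 < μ) (hk₁ : 0 < k₁) (hk₂ : 0 < k₂)
    (hη : η = Real.sqrt (μ * (k₁ + k₂) / (k₁ * k₂)))
    (D₁ D₂ S : ℝ)
    (hD₁ : D₁ = (k₁ + k₂) / (k₁ * η * (Real.exp η + 1) + 2 * k₂ * (Real.exp η - 1)))
    (hD₂ : D₂ = -(Real.exp η) * D₁)
    (hS : S = 2 + Real.cosh (η / 2) / Real.sinh (η / 2) * (k₁ * η / k₂))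
    (p₁ p₂ u₁ u₂ : ℝ → ℝ)
    (hp₁ : ∀ x, p₁ x = 1 - x - (1 - 2 * x) / S
      - μ / (k₁ * η ^ 2) * (D₁ * Real.exp (η * x) + D₂ * Real.exp (-(η * x))))
    (hp₂ : ∀ x, p₂ x = 1 - x - (1 - 2 * x) / S
      + μ / (k₂ * η ^ 2) * (D₁ * Real.exp (η * x) + D₂ * Real.exp (-(η * x))))
    (hu₁ : ∀ x, u₁ x = k₁ / μ - k₁ / μ * (2 / S)
      + 1 / η * (D₁ * Real.exp (η * x) - D₂ * Real.exp (-(η * x))))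
    (hu₂ : ∀ x, u₂ x = k₂ / μ - k₂ / μ * (2 / S)
      - 1 / η * (D₁ * Real.exp (η * x) - D₂ * Real.exp (-(η * x)))) :
    (∀ x ∈ Ioo (0:ℝ) 1,
      DifferentiableAt ℝ u₁ x ∧ DifferentiableAt ℝ u₂ x ∧
      DifferentiableAt ℝ p₁ x ∧ DifferentiableAt ℝ p₂ x ∧
      μ / k₁ * u₁ x + deriv p₁ x = 0 ∧
      deriv u₁ x = -(p₁ x - p₂ x) ∧
      μ / k₂ * u₂ x + deriv p₂ x = 0 ∧
      deriv u₂ x = p₁ x - p₂ x) ∧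
    p₁ 0 = 1 ∧ p₁ 1 = 0 ∧ u₂ 0 = 0 ∧ u₂ 1 = 0 := by
  have hη0 : 0 < η := hη ▸ Real.sqrt_pos.mpr (by positivity)
  have hη2 : η ^ 2 = μ * (k₁ + k₂) / (k₁ * k₂) := by
    rw [hη, Real.sq_sqrt (by positivity)]
  have hμη : μ * (k₁ + k₂) = η ^ 2 * (k₁ * k₂) := by
    rw [hη2]; field_simp
  have hE : 0 < Real.exp η - 1 := sub_pos.mpr (Real.one_lt_exp_iff.mpr hη0)
  have hQ : 0 < k₁ * η * (Real.exp η + 1) + 2 * k₂ * (Real.exp η - 1) := by positivity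
  have hSinv : 1 / S = k₂ * (Real.exp η - 1) /
      (k₁ * η * (Real.exp η + 1) + 2 * k₂ * (Real.exp η - 1)) := by
    have hSeq : S = (k₁ * η * (Real.exp η + 1) + 2 * k₂ * (Real.exp η - 1)) /
        (k₂ * (Real.exp η - 1)) := by
      rw [hS, cosh_half_div_sinh_half]
      field_simp
      ring
    rw [hSeq, one_div_div]
  have hc₁ : μ / (k₁ * η ^ 2) = k₂ / (k₁ + k₂) := by
    rw [div_eq_div_iff (by positivity) (by positivity)]
    linear_combination hμη
  have hpressure : 1 / S = k₂ / (k₁ + k₂) * (D₁ * (Real.exp η - 1)) := by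
    rw [hSinv, hD₁]
    field_simp
  have hflux : k₂ / μ - k₂ / μ * (2 / S) = 1 / η * (D₁ * (Real.exp η + 1)) := by
    have h : 1 - 2 * (1 / S) = k₁ * η * (Real.exp η + 1) /
        (k₁ * η * (Real.exp η + 1) + 2 * k₂ * (Real.exp η - 1)) := by
      rw [hSinv, eq_div_iff hQ.ne', sub_mul, mul_assoc 2 (_ / _), div_mul_cancel₀ _ hQ.ne']
      ring
    have hc : k₂ / μ * (k₁ * η) = 1 / η * (k₁ + k₂) := by
      field_simp
      linear_combination -hμη
    calc k₂ / μ - k₂ / μ * (2 / S) = k₂ / μ * (1 - 2 * (1 / S)) := by ring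
      _ = 1 / η * (D₁ * (Real.exp η + 1)) := by
        rw [h, hD₁]
        linear_combination (Real.exp η + 1) /
          (k₁ * η * (Real.exp η + 1) + 2 * k₂ * (Real.exp η - 1)) * hc
  have hexp : Real.exp η * Real.exp (-η) = 1 := by
    rw [← Real.exp_add, add_neg_cancel, Real.exp_zero]
  refine ⟨fun x _ ↦ ?_, ?_, ?_, ?_, ?_⟩
  · have hsum := hasDerivAt_exp_combination D₁ D₂ η x
    have hdiff : HasDerivAt
        (fun y ↦ D₁ * Real.exp (η * y) - D₂ * Real.exp (-(η * y)))
        (η * (D₁ * Real.exp (η * x) + D₂ * Real.exp (-(η * x)))) x := by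
      simpa [sub_eq_add_neg] using hasDerivAt_exp_combination D₁ (-D₂) η x
    have hlin : HasDerivAt (fun y : ℝ ↦ 1 - y - (1 - 2 * y) / S) (-1 + 2 / S) x :=
      (((hasDerivAt_id' x).const_sub 1).fun_sub
        ((((hasDerivAt_id' x).const_mul 2).const_sub 1).div_const S)).congr_deriv (by ring)
    have du₁ := (hdiff.const_mul (1 / η)).const_add (k₁ / μ - k₁ / μ * (2 / S))
    have du₂ := (hdiff.const_mul (1 / η)).const_sub (k₂ / μ - k₂ / μ * (2 / S))
    have dp₁ := hlin.fun_sub (hsum.const_mul (μ / (k₁ * η ^ 2)))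
    have dp₂ := hlin.fun_add (hsum.const_mul (μ / (k₂ * η ^ 2)))
    rw [← funext hu₁] at du₁
    rw [← funext hu₂] at du₂
    rw [← funext hp₁] at dp₁
    rw [← funext hp₂] at dp₂
    have hc : μ / (k₁ * η ^ 2) + μ / (k₂ * η ^ 2) = 1 := by
      field_simp
      linear_combination hμη
    have hη' : 1 / η * η = 1 := one_div_mul_cancel hη0.ne'
    refine ⟨du₁.differentiableAt, du₂.differentiableAt, dp₁.differentiableAt,
      dp₂.differentiableAt, ?_, ?_, ?_, ?_⟩
    · rw [dp₁.deriv, hu₁]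
      field_simp
      ring
    · rw [du₁.deriv, hp₁, hp₂]
      linear_combination (D₁ * Real.exp (η * x) + D₂ * Real.exp (-(η * x))) * (hη' - hc)
    · rw [dp₂.deriv, hu₂]
      field_simp
      ring
    · rw [du₂.deriv, hp₁, hp₂]
      linear_combination (D₁ * Real.exp (η * x) + D₂ * Real.exp (-(η * x))) * (hc - hη')
  · rw [hp₁, hc₁, hD₂]
    simp only [mul_zero, neg_zero, Real.exp_zero]
    linear_combination -hpressure
  · rw [hp₁, hc₁, hD₂]
    simp only [mul_one]
    linear_combination hpressure + k₂ / (k₁ + k₂) * D₁ * hexp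
  · rw [hu₂, hD₂]
    simp only [mul_zero, neg_zero, Real.exp_zero]
    linear_combination hflux
  · rw [hu₂, hD₂]
    simp only [mul_one]
    linear_combination hflux - 1 / η * D₁ * hexp
end
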